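/- arXiv:2508.11308 — 2 statements merged into one kernel-verified Lean document; each statement's English description precedes it below -/
import Mathlib

section
/- Let W be a normalized 3×3 entanglement witness (on Fin 3 × Fin 3) with negativity N(W) = 1. Then the partial transpose W^Γ is positive semidefinite; in particular, W is decomposable. (Hence the supremum 1 of the negativity is never attained by a nondecomposable 3×3 entanglement witness.) -/
open Matrix ComplexOrder

noncomputable section

/-- The product vector `a ⊗ b`. -/
def prodVec {m n : ℕ} (a : Fin m → ℂ) (b : Fin n → ℂ) : Fin m × Fin n → ℂ :=
  fun p => a p.1 * b p.2

/-- `W` is block-positive: Hermitian, and the quadratic form on every product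
vector is real and nonnegative. -/
def BlockPositive {m n : ℕ} (W : Matrix (Fin m × Fin n) (Fin m × Fin n) ℂ) : Prop :=
  W.IsHermitian ∧ ∀ (a : Fin m → ℂ) (b : Fin n → ℂ),
    0 ≤ (star (prodVec a b) ⬝ᵥ W.mulVec (prodVec a b)).re ∧
    (star (prodVec a b) ⬝ᵥ W.mulVec (prodVec a b)).im = 0

/-- Partial transpose: `M^Γ ((i,k),(j,l)) = M ((j,k),(i,l))`. -/
def ptrans {m n : ℕ} (M : Matrix (Fin m × Fin n) (Fin m × Fin n) ℂ) :
    Matrix (Fin m × Fin n) (Fin m × Fin n) ℂ :=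
  fun p q => M (q.1, p.2) (p.1, q.2)

/-- `W` is decomposable: `W = P + Q^Γ` with `P, Q` positive semidefinite. -/
def Decomposable {m n : ℕ} (W : Matrix (Fin m × Fin n) (Fin m × Fin n) ℂ) : Prop :=
  ∃ P Q : Matrix (Fin m × Fin n) (Fin m × Fin n) ℂ,
    P.PosSemidef ∧ Q.PosSemidef ∧ W = P + ptrans Q

/-- Negativity: absolute value of the sum of the negative eigenvalues. -/
noncomputable def negativity {N : Type*} [Fintype N] [DecidableEq N]
    {W : Matrix N N ℂ} (hW : W.IsHermitian) : ℝ :=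
  ∑ i, max (-(hW.eigenvalues i)) 0

/-- The eigenvalues of a Hermitian matrix, listed in non-increasing order with
multiplicity. -/
noncomputable def sortedEigs {N : Type*} [Fintype N] [DecidableEq N]
    {W : Matrix N N ℂ} (hW : W.IsHermitian) : List ℝ :=
  (Finset.univ.val.map hW.eigenvalues).sort (· ≥ ·)

/-- The slice of `W` at `a` in the first factor. -/
def slice (W : Matrix (Fin 3 × Fin 3) (Fin 3 × Fin 3) ℂ) (a : Fin 3 → ℂ) :
    Matrix (Fin 3) (Fin 3) ℂ :=
  fun k l => ∑ i, ∑ j, star (a i) * W (i, k) (j, l) * a j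

lemma slice_quad (W : Matrix (Fin 3 × Fin 3) (Fin 3 × Fin 3) ℂ) (a b : Fin 3 → ℂ) :
    star b ⬝ᵥ (slice W a).mulVec b = star (prodVec a b) ⬝ᵥ W.mulVec (prodVec a b) := by
  simp only [dotProduct, mulVec, slice, prodVec, Fintype.sum_prod_type, Fin.sum_univ_three,
    Pi.star_apply, star_mul']
  ring

lemma slice_psd {W : Matrix (Fin 3 × Fin 3) (Fin 3 × Fin 3) ℂ} (h : BlockPositive W)
    (a : Fin 3 → ℂ) : (slice W a).PosSemidef := by
  refine PosSemidef.of_dotProduct_mulVec_nonneg ?_ ?_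
  · ext k l
    have := h.1
    simp only [conjTranspose_apply, slice, star_sum, star_mul', star_star]
    rw [Finset.sum_comm]
    refine Finset.sum_congr rfl fun i _ => Finset.sum_congr rfl fun j _ => ?_
    rw [this.apply]; ring
  · intro b
    rw [slice_quad]
    obtain ⟨h1, h2⟩ := h.2 a b
    rw [Complex.le_def]
    exact ⟨h1, h2.symm⟩

/-- quadratic form -/
def quad (X : Fin 3 → Fin 3 → ℂ) (a : Fin 3 → ℂ) : ℂ := ∑ i, ∑ j, star (a i) * X i j * a j

def ph : Fin 4 → ℂ := ![1, -1, Complex.I, -Complex.I]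

lemma ph_avg (p q r p' q' r' : ℂ) :
    ∑ s, (p + ph s * q + star (ph s) * r) * (p' + ph s * q' + star (ph s) * r')
      = 4 * (p * p' + q * r' + r * q') := by
  simp [Fin.sum_univ_four, ph]
  linear_combination (2 * q * q' + 2 * r * r' -2 * q * r' - 2 * r * q') * Complex.I_sq

lemma ph_norm (s : Fin 4) : star (ph s) * ph s = 1 := by
  fin_cases s <;> simp [ph]

def dvec (s t : Fin 4) : Fin 3 → ℂ := ![1, ph s, ph t]

lemma design (X Y : Fin 3 → Fin 3 → ℂ) :
    ∑ t, ∑ s, quad X (dvec s t) * quad Y (dvec s t)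
      + 16 * ∑ i, quad X (Pi.single i 1) * quad Y (Pi.single i 1)
      = 16 * ((∑ i, X i i) * (∑ i, Y i i) + ∑ i, ∑ j, X i j * Y j i) := by
  have e : ∀ (X : Fin 3 → Fin 3 → ℂ) s t, quad X (dvec s t) =
      (X 0 0 + X 1 1 + X 2 2 + ph t * X 0 2 + star (ph t) * X 2 0)
      + ph s * (X 0 1 + star (ph t) * X 2 1) + star (ph s) * (X 1 0 + ph t * X 1 2) := by
    intro X s t
    simp only [quad, dvec, Fin.sum_univ_three]
    simp only [Matrix.cons_val_zero, Matrix.cons_val_one, Matrix.cons_val, star_one]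
    linear_combination (X 1 1) * ph_norm s + (X 2 2) * ph_norm t
  have e2 : ∀ (X : Fin 3 → Fin 3 → ℂ) i, quad X (Pi.single i 1) = X i i := by
    intro X i
    fin_cases i <;> simp [quad, Fin.sum_univ_three]
  simp only [e, e2, ph_avg]
  have h1 := ph_avg (X 0 0 + X 1 1 + X 2 2) (X 0 2) (X 2 0) (Y 0 0 + Y 1 1 + Y 2 2) (Y 0 2) (Y 2 0)
  have h2 := ph_avg (X 0 1) 0 (X 2 1) (Y 1 0) (Y 1 2) 0
  have h3 := ph_avg (X 1 0) (X 1 2) 0 (Y 0 1) 0 (Y 2 1)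
  simp only [mul_zero, add_zero] at h2 h3
  rw [← Finset.mul_sum, Finset.sum_add_distrib, Finset.sum_add_distrib, h1, h2, h3]
  simp only [Fin.sum_univ_three]
  ring

/-- gap -/
def gap (M : Matrix (Fin 3) (Fin 3) ℂ) : ℂ := ∑ k, ∑ l, (M k k * M l l - M k l * M l k)

lemma gap_eq (M : Matrix (Fin 3) (Fin 3) ℂ) : gap M = M.trace ^ 2 - (M * M).trace := by
  simp only [gap, trace, Matrix.mul_apply, Fin.sum_univ_three, diag_apply]
  ring

lemma gap_nonneg {M : Matrix (Fin 3) (Fin 3) ℂ} (h : M.PosSemidef) : 0 ≤ gap M := by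
  refine Finset.sum_nonneg fun k _ => Finset.sum_nonneg fun l _ => ?_
  have := (h.submatrix ![k, l]).det_nonneg
  rw [det_fin_two] at this
  simpa using this

def Dm (W : Matrix (Fin 3 × Fin 3) (Fin 3 × Fin 3) ℂ) : Matrix (Fin 3) (Fin 3) ℂ :=
  fun i j => ∑ k, W (i, k) (j, k)
def Em (W : Matrix (Fin 3 × Fin 3) (Fin 3 × Fin 3) ℂ) : Matrix (Fin 3) (Fin 3) ℂ :=
  fun k l => ∑ i, W (i, k) (i, l)

lemma gap_sum (W : Matrix (Fin 3 × Fin 3) (Fin 3 × Fin 3) ℂ) :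
    ∑ t, ∑ s, gap (slice W (dvec s t)) + 16 * ∑ i, gap (slice W (Pi.single i 1))
      = 16 * (W.trace ^ 2 + (Dm W * Dm W).trace - (Em W * Em W).trace - (W * W).trace) := by
  have e : ∀ a k l, slice W a k l = quad (fun i j => W (i, k) (j, l)) a := fun _ _ _ => rfl
  have h := fun k l => design (fun i j => W (i, k) (j, k)) (fun i j => W (i, l) (j, l))
  have h' := fun k l => design (fun i j => W (i, k) (j, l)) (fun i j => W (i, l) (j, k))
  have L : ∑ t, ∑ s, gap (slice W (dvec s t)) + 16 * ∑ i, gap (slice W (Pi.single i 1))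
     = ∑ k, ∑ l, ((∑ t, ∑ s, slice W (dvec s t) k k * slice W (dvec s t) l l
      + 16 * ∑ i, slice W (Pi.single i 1) k k * slice W (Pi.single i 1) l l) -
      (∑ t, ∑ s, slice W (dvec s t) k l * slice W (dvec s t) l k
      + 16 * ∑ i, slice W (Pi.single i 1) k l * slice W (Pi.single i 1) l k)) := by
    simp only [gap, Fin.sum_univ_three, Fin.sum_univ_four]
    ring
  rw [L]
  simp only [e, h, h']
  simp only [trace, Matrix.mul_apply, Dm, Em, diag_apply, Fintype.sum_prod_type,
    Fin.sum_univ_three]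
  ring

abbrev Sw (W : Matrix (Fin 3 × Fin 3) (Fin 3 × Fin 3) ℂ) :
    Matrix (Fin 3 × Fin 3) (Fin 3 × Fin 3) ℂ := W.submatrix Prod.swap Prod.swap

lemma Sw_bp {W : Matrix (Fin 3 × Fin 3) (Fin 3 × Fin 3) ℂ} (h : BlockPositive W) :
    BlockPositive (Sw W) := by
  refine ⟨h.1.submatrix _, fun a b => ?_⟩
  have : star (prodVec a b) ⬝ᵥ (Sw W).mulVec (prodVec a b) =
      star (prodVec b a) ⬝ᵥ W.mulVec (prodVec b a) := by
    simp only [dotProduct, mulVec, prodVec, Fintype.sum_prod_type, Fin.sum_univ_three,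
      Pi.star_apply, star_mul', submatrix_apply, Prod.swap_prod_mk]
    ring
  rw [this]; exact h.2 b a

lemma Sw_sq (W : Matrix (Fin 3 × Fin 3) (Fin 3 × Fin 3) ℂ) : Sw W * Sw W = Sw (W * W) := by
  exact Matrix.submatrix_mul_equiv W W Prod.swap (Equiv.prodComm _ _) Prod.swap

lemma Sw_trace (W : Matrix (Fin 3 × Fin 3) (Fin 3 × Fin 3) ℂ) : (Sw W).trace = W.trace := by
  simp only [trace, diag_apply, submatrix_apply, Fintype.sum_prod_type, Prod.swap_prod_mk]
  exact Finset.sum_comm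

lemma key_ineq {W : Matrix (Fin 3 × Fin 3) (Fin 3 × Fin 3) ℂ} (h : BlockPositive W) :
    0 ≤ W.trace ^ 2 + (Dm W * Dm W).trace - (Em W * Em W).trace - (W * W).trace := by
  have := gap_sum W
  have h1 : 0 ≤ ∑ t, ∑ s, gap (slice W (dvec s t)) + 16 * ∑ i, gap (slice W (Pi.single i 1)) :=
    add_nonneg (Finset.sum_nonneg fun _ _ => Finset.sum_nonneg fun _ _ => gap_nonneg (slice_psd h _))
      (mul_nonneg (by norm_num) (Finset.sum_nonneg fun _ _ => gap_nonneg (slice_psd h _)))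
  rw [this] at h1
  have h16 : (0:ℂ) ≤ 1 / 16 := by rw [Complex.le_def]; norm_num
  convert mul_nonneg h16 h1 using 1; ring

lemma key_ineq' {W : Matrix (Fin 3 × Fin 3) (Fin 3 × Fin 3) ℂ} (h : BlockPositive W) :
    0 ≤ W.trace ^ 2 + (Em W * Em W).trace - (Dm W * Dm W).trace - (W * W).trace := by
  have := key_ineq (Sw_bp h)
  rwa [Sw_sq, Sw_trace, Sw_trace] at this

lemma tr_sq_le {W : Matrix (Fin 3 × Fin 3) (Fin 3 × Fin 3) ℂ} (h : BlockPositive W) :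
    (W * W).trace ≤ W.trace ^ 2 := by
  have := add_nonneg (key_ineq h) (key_ineq' h)
  have h2 : (0:ℂ) ≤ 1 / 2 := by rw [Complex.le_def]; norm_num
  rw [← sub_nonneg]
  convert mul_nonneg h2 this using 1; ring

lemma gap_zero {W : Matrix (Fin 3 × Fin 3) (Fin 3 × Fin 3) ℂ} (h : BlockPositive W)
    (ht : W.trace = 1) (h2 : (W * W).trace = 1) (i : Fin 3) :
    gap (slice W (Pi.single i 1)) = 0 := by
  have k1 := key_ineq h
  have k2 := key_ineq' h
  rw [ht, h2] at k1 k2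
  have k3 : (1:ℂ) ^ 2 + (Dm W * Dm W).trace - (Em W * Em W).trace - 1 = 0 := by
    refine le_antisymm ?_ k1
    rw [← neg_nonneg]; convert k2 using 1; ring
  have hs := gap_sum W
  rw [ht, h2, k3, mul_zero] at hs
  have n1 : 0 ≤ ∑ t, ∑ s, gap (slice W (dvec s t)) :=
    (Finset.sum_nonneg fun _ _ => Finset.sum_nonneg fun _ _ => gap_nonneg (slice_psd h _))
  have n2 : ∀ i ∈ Finset.univ, 0 ≤ gap (slice W (Pi.single i 1)) :=
    fun _ _ => gap_nonneg (slice_psd h _)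
  have n3 : 0 ≤ 16 * ∑ i, gap (slice W (Pi.single i 1)) :=
      (mul_nonneg (by norm_num) (Finset.sum_nonneg n2))
  have := ((add_eq_zero_iff_of_nonneg n1 n3).1 hs).2
  have := (mul_eq_zero.1 this).resolve_left (by norm_num)
  exact (Finset.sum_eq_zero_iff_of_nonneg n2).1 this i (Finset.mem_univ _)
lemma herm_sq {n : Type*} [Fintype n] [DecidableEq n] {M : Matrix n n ℂ} (h : M.IsHermitian) :
    M * M = (h.eigenvectorUnitary : Matrix n n ℂ) *
      diagonal (fun i => ((h.eigenvalues i ^ 2 : ℝ) : ℂ)) *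
      star (h.eigenvectorUnitary : Matrix n n ℂ) := by
  have hs := h.spectral_theorem
  rw [Unitary.conjStarAlgAut_apply] at hs
  have hu : star (h.eigenvectorUnitary : Matrix n n ℂ) * (h.eigenvectorUnitary : Matrix n n ℂ) = 1 :=
    Unitary.coe_star_mul_self _
  set U := (h.eigenvectorUnitary : Matrix n n ℂ)
  have hd : diagonal (fun i => ((h.eigenvalues i ^ 2 : ℝ) : ℂ)) =
      diagonal (RCLike.ofReal ∘ h.eigenvalues) * diagonal (RCLike.ofReal ∘ h.eigenvalues) := by
    rw [diagonal_mul_diagonal]; congr 1; ext i; simp [sq]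
  rw [hd]
  calc M * M = (U * diagonal (RCLike.ofReal ∘ h.eigenvalues) * star U) *
        (U * diagonal (RCLike.ofReal ∘ h.eigenvalues) * star U) := by rw [← hs]
    _ = U * diagonal (RCLike.ofReal ∘ h.eigenvalues) * (star U * U) *
        diagonal (RCLike.ofReal ∘ h.eigenvalues) * star U := by simp only [mul_assoc]
    _ = _ := by rw [hu]; simp only [mul_assoc, one_mul]

lemma herm_sq_trace {n : Type*} [Fintype n] [DecidableEq n] {M : Matrix n n ℂ}
    (h : M.IsHermitian) : (M * M).trace = ((∑ i, h.eigenvalues i ^ 2 : ℝ) : ℂ) := by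
  rw [herm_sq h, trace_mul_comm, ← mul_assoc, Unitary.coe_star_mul_self, one_mul]
  simp [trace]

lemma rank_one {M : Matrix (Fin 3) (Fin 3) ℂ} (h : M.PosSemidef) (hg : gap M = 0) :
    ∃ u : Fin 3 → ℂ, star u ⬝ᵥ u = 1 ∧ M *ᵥ u = M.trace • u := by
  have hH := h.1
  have hnn := h.eigenvalues_nonneg
  rw [gap_eq, herm_sq_trace hH, hH.trace_eq_sum_eigenvalues, sub_eq_zero] at hg
  have hg' : (∑ i, hH.eigenvalues i) ^ 2 = ∑ i, hH.eigenvalues i ^ 2 := by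
    have e : ∀ x : ℝ, (RCLike.ofReal x : ℂ) = (x : ℂ) := fun _ => rfl
    simp only [e] at hg
    exact_mod_cast hg
  have : ∃ j, hH.eigenvalues j = ∑ i, hH.eigenvalues i := by
    simp only [Fin.sum_univ_three] at hg' ⊢
    have a := hnn 0
    have b := hnn 1
    have c := hnn 2
    change 0 ≤ hH.eigenvalues 0 at a
    change 0 ≤ hH.eigenvalues 1 at b
    change 0 ≤ hH.eigenvalues 2 at c
    have ab := mul_nonneg a b
    have ac := mul_nonneg a c
    have bc := mul_nonneg b c
    have ab0 : hH.eigenvalues 0 * hH.eigenvalues 1 = 0 := by nlinarith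
    have ac0 : hH.eigenvalues 0 * hH.eigenvalues 2 = 0 := by nlinarith
    have bc0 : hH.eigenvalues 1 * hH.eigenvalues 2 = 0 := by nlinarith
    rcases mul_eq_zero.1 ab0 with h0 | h1
    · rcases mul_eq_zero.1 bc0 with h1 | h2
      · exact ⟨2, by rw [h0, h1]; ring⟩
      · exact ⟨1, by rw [h0, h2]; ring⟩
    · rcases mul_eq_zero.1 ac0 with h0 | h2
      · exact ⟨2, by rw [h0, h1]; ring⟩
      · exact ⟨0, by rw [h1, h2]; ring⟩
  obtain ⟨j, hj⟩ := this
  refine ⟨hH.eigenvectorBasis j, ?_, ?_⟩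
  · have := hH.eigenvectorBasis.orthonormal.1 j
    have h2 := inner_self_eq_norm_sq_to_K (𝕜 := ℂ) (hH.eigenvectorBasis j)
    rw [this, EuclideanSpace.inner_eq_star_dotProduct, dotProduct_comm] at h2
    simpa using h2
  · have := hH.mulVec_eigenvectorBasis j
    rw [hH.trace_eq_sum_eigenvalues, this, hj]
    ext i
    simp

structure HW (W : Matrix (Fin 3 × Fin 3) (Fin 3 × Fin 3) ℂ) : Prop where
  bp : BlockPositive W
  sq : W * W = (1 / 9 : ℂ) • 1
  tr : W.trace = 1

lemma HW.trsq {W : Matrix (Fin 3 × Fin 3) (Fin 3 × Fin 3) ℂ} (h : HW W) : (W * W).trace = 1 := by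
  rw [h.sq, trace_smul, trace_one]; simp

lemma HW.psd {W : Matrix (Fin 3 × Fin 3) (Fin 3 × Fin 3) ℂ} (h : HW W) :
    ((1 / 3 : ℂ) • 1 - W).PosSemidef := by
  have hh : ((1 / 3 : ℂ) • 1 - W)ᴴ = (1 / 3 : ℂ) • 1 - W := by
    rw [conjTranspose_sub, h.bp.1.eq, conjTranspose_smul, conjTranspose_one]; simp
  have : (1 / 3 : ℂ) • 1 - W =
      (3 / 2 : ℂ) • (((1 / 3 : ℂ) • 1 - W)ᴴ * ((1 / 3 : ℂ) • 1 - W)) := by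
    rw [hh, mul_sub, sub_mul, sub_mul, h.sq]
    simp only [smul_mul_assoc, mul_smul_comm, one_mul, mul_one]
    module
  rw [this]
  exact (posSemidef_conjTranspose_mul_self _).smul (by rw [Complex.le_def]; norm_num)

lemma HW.sw {W : Matrix (Fin 3 × Fin 3) (Fin 3 × Fin 3) ℂ} (h : HW W) : HW (Sw W) where
  bp := Sw_bp h.bp
  sq := by
    rw [Sw_sq, h.sq]
    ext ⟨i, k⟩ ⟨j, l⟩
    simp [Matrix.one_apply, and_comm]
  tr := by rw [Sw_trace, h.tr]

lemma slice_single (W : Matrix (Fin 3 × Fin 3) (Fin 3 × Fin 3) ℂ) (i k l : Fin 3) :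
    slice W (Pi.single i 1) k l = W (i, k) (i, l) := by
  fin_cases i <;> simp [slice, Fin.sum_univ_three]

lemma HW.slice_prop {W : Matrix (Fin 3 × Fin 3) (Fin 3 × Fin 3) ℂ} (h : HW W) :
    ∀ i, (slice W (Pi.single i 1)).trace = 1 / 3 ∧ ∃ u : Fin 3 → ℂ, star u ⬝ᵥ u = 1 ∧
      slice W (Pi.single i 1) *ᵥ u = (1 / 3 : ℂ) • u := by
  have r := fun i => rank_one (slice_psd h.bp (Pi.single i 1)) (gap_zero h.bp h.tr h.trsq i)
  have le : ∀ i, (slice W (Pi.single i 1)).trace ≤ 1 / 3 := by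
    intro i
    obtain ⟨u, hu, hM⟩ := r i
    have e1 := slice_quad W (Pi.single i 1) u
    rw [hM, dotProduct_smul, hu, smul_eq_mul, mul_one] at e1
    have e2 := h.psd.dotProduct_mulVec_nonneg (prodVec (Pi.single i 1) u)
    rw [sub_mulVec, dotProduct_sub, ← e1, smul_mulVec, one_mulVec, dotProduct_smul] at e2
    have e3 : star (prodVec (Pi.single i 1) u) ⬝ᵥ prodVec (Pi.single i 1) u = star u ⬝ᵥ u := by
      fin_cases i <;>
      simp [prodVec, dotProduct, Fintype.sum_prod_type, Fin.sum_univ_three]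
    rw [e3, hu, smul_eq_mul, mul_one, sub_nonneg] at e2
    exact e2
  have hsum : ∑ i, (1 / 3 - (slice W (Pi.single i 1)).trace) = 0 := by
    have : ∑ i, (slice W (Pi.single i 1)).trace = W.trace := by
      simp only [trace, diag_apply, slice_single, Fintype.sum_prod_type]
    rw [Finset.sum_sub_distrib, this, h.tr]; simp
  have e := (Finset.sum_eq_zero_iff_of_nonneg (fun i _ => sub_nonneg.2 (le i))).1 hsum
  intro i
  have ei : (slice W (Pi.single i 1)).trace = 1 / 3 := (sub_eq_zero.1 (e i (Finset.mem_univ _))).symm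
  refine ⟨ei, ?_⟩
  have := r i
  rwa [ei] at this

/-- conjugation by a local operator on the second factor -/
def Cj (V : Matrix (Fin 3) (Fin 3) ℂ) (W : Matrix (Fin 3 × Fin 3) (Fin 3 × Fin 3) ℂ) :
    Matrix (Fin 3 × Fin 3) (Fin 3 × Fin 3) ℂ :=
  fun p q => ∑ x, ∑ y, V p.2 x * W (p.1, x) (q.1, y) * star (V q.2 y)

lemma Cj_eq (V : Matrix (Fin 3) (Fin 3) ℂ) (W : Matrix (Fin 3 × Fin 3) (Fin 3 × Fin 3) ℂ) :
    Cj V W = kronecker 1 V * W * (kronecker 1 V)ᴴ := by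
  ext ⟨i, k⟩ ⟨j, l⟩
  simp only [Cj, Matrix.mul_apply, kronecker, kroneckerMap_apply, conjTranspose_apply,
    Fintype.sum_prod_type, Matrix.one_apply]
  fin_cases i <;> fin_cases j <;> simp [Fin.sum_univ_three] <;> ring

lemma Cj_quad (V : Matrix (Fin 3) (Fin 3) ℂ) (W : Matrix (Fin 3 × Fin 3) (Fin 3 × Fin 3) ℂ)
    (a b : Fin 3 → ℂ) : star (prodVec a b) ⬝ᵥ (Cj V W).mulVec (prodVec a b) =
      star (prodVec a (Vᴴ *ᵥ b)) ⬝ᵥ W.mulVec (prodVec a (Vᴴ *ᵥ b)) := by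
  have : prodVec a (Vᴴ *ᵥ b) = (kronecker 1 V)ᴴ *ᵥ prodVec a b := by
    ext ⟨i, k⟩
    simp only [prodVec, mulVec, dotProduct, kronecker, kroneckerMap_apply, conjTranspose_apply,
      Fintype.sum_prod_type, Matrix.one_apply]
    fin_cases i <;> simp [Fin.sum_univ_three] <;> ring
  rw [this, Cj_eq, star_mulVec, conjTranspose_conjTranspose, ← dotProduct_mulVec, mulVec_mulVec,
    mulVec_mulVec]

lemma kron_unit {V : Matrix (Fin 3) (Fin 3) ℂ} (hV : Vᴴ * V = 1) :
    (kronecker (1 : Matrix (Fin 3) (Fin 3) ℂ) V)ᴴ * kronecker 1 V = 1 := by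
  rw [kronecker, conjTranspose_kronecker, ← mul_kronecker_mul, hV]; simp

lemma HW.cj {W : Matrix (Fin 3 × Fin 3) (Fin 3 × Fin 3) ℂ} (h : HW W)
    {V : Matrix (Fin 3) (Fin 3) ℂ} (hV : Vᴴ * V = 1) : HW (Cj V W) := by
  have hk := kron_unit hV
  have hk' := mul_eq_one_comm.1 hk
  refine ⟨⟨?_, ?_⟩, ?_, ?_⟩
  · rw [Cj_eq]; exact isHermitian_mul_mul_conjTranspose _ h.bp.1
  · intro a b; rw [Cj_quad]; exact h.bp.2 _ _
  · rw [Cj_eq]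
    generalize (kronecker (1 : Matrix (Fin 3) (Fin 3) ℂ) V) = K at *
    calc K * W * Kᴴ * (K * W * Kᴴ) = K * W * (Kᴴ * K) * W * Kᴴ := by simp only [mul_assoc]
      _ = K * (W * W) * Kᴴ := by rw [hk]; simp only [mul_assoc, one_mul]
      _ = _ := by rw [h.sq]; simp [hk']
  · rw [Cj_eq, trace_mul_comm, ← mul_assoc, hk, one_mul, h.tr]

lemma HW.em {W : Matrix (Fin 3 × Fin 3) (Fin 3 × Fin 3) ℂ} (h : HW W) :
    Em W = (1 / 3 : ℂ) • 1 := by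
  have hH : (Em W).IsHermitian := by
    ext k l
    simp only [conjTranspose_apply, Em, star_sum]
    exact Finset.sum_congr rfl fun i _ => h.bp.1.apply _ _
  have hs := hH.spectral_theorem
  have hs' := hH.conjStarAlgAut_star_eigenvectorUnitary
  rw [Unitary.conjStarAlgAut_apply] at hs hs'
  have hu : star (hH.eigenvectorUnitary : Matrix (Fin 3) (Fin 3) ℂ) *
      (hH.eigenvectorUnitary : Matrix (Fin 3) (Fin 3) ℂ) = 1 :=
    Unitary.coe_star_mul_self _
  simp only [Unitary.coe_star, star_star] at hs hs'
  set U := (hH.eigenvectorUnitary : Matrix (Fin 3) (Fin 3) ℂ)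
  have hu' := mul_eq_one_comm.1 hu
  have h2 := (h.cj (V := star U) (by rw [← star_eq_conjTranspose, star_star]; exact hu')).sw.slice_prop
  have h3 : ∀ k, (hH.eigenvalues k : ℂ) = 1 / 3 := by
    intro k
    rw [← (h2 k).1]
    have := congrFun (congrFun hs' k) k
    rw [diagonal_apply_eq] at this
    refine Eq.trans this.symm ?_
    simp only [trace, diag_apply, slice_single, submatrix_apply, Prod.swap_prod_mk, Cj,
      Matrix.mul_apply, Em, star_apply, star_star, Fin.sum_univ_three]
    ring
  have h4 : diagonal (RCLike.ofReal ∘ hH.eigenvalues) = (1 / 3 : ℂ) • (1 : Matrix (Fin 3) (Fin 3) ℂ) := by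
    rw [smul_one_eq_diagonal]
    congr 1; ext k; exact h3 k
  rw [hs, h4]; simp [hu']
lemma psd_zero {n : Type*} [Fintype n] [DecidableEq n] {M : Matrix n n ℂ} (h : M.PosSemidef)
    {k : n} (hk : M k k = 0) (l : n) : M l k = 0 ∧ M k l = 0 := by
  have h1 := (h.dotProduct_mulVec_zero_iff (Pi.single k 1)).1 (by simp [hk])
  have h2 : M l k = 0 := by simpa using congrFun h1 l
  refine ⟨h2, ?_⟩
  rw [← h.1.apply, h2, star_zero]

lemma slice_two (W : Matrix (Fin 3 × Fin 3) (Fin 3 × Fin 3) ℂ) {i j : Fin 3} (hij : i ≠ j) (s : ℂ)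
    (k l : Fin 3) : slice W (Pi.single j 1 + Pi.single i s) k l =
      W (j, k) (j, l) + star s * s * W (i, k) (i, l) + s * W (j, k) (i, l)
        + star s * W (i, k) (j, l) := by
  fin_cases i <;> fin_cases j <;> simp [slice, Fin.sum_univ_three] at hij ⊢ <;> ring

section canon
variable {W : Matrix (Fin 3 × Fin 3) (Fin 3 × Fin 3) ℂ}

lemma canon_diag (h : HW W) (hd : ∀ i, W (i, i) (i, i) = 1 / 3) {i k : Fin 3} (hik : i ≠ k) :
    W (i, k) (i, k) = 0 := by
  have ht := (h.slice_prop i).1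
  have hp := slice_psd h.bp (Pi.single i 1)
  have hn : ∀ l, 0 ≤ W (i, l) (i, l) := fun l => by
    have := hp.diag_nonneg (i := l); rwa [slice_single] at this
  simp only [trace, diag_apply, slice_single] at ht
  rw [← Finset.add_sum_erase _ _ (Finset.mem_univ i), hd, add_eq_left] at ht
  exact (Finset.sum_eq_zero_iff_of_nonneg fun l _ => hn l).1 ht k (by simp [hik.symm])

lemma canon_col (h : HW W) (hd : ∀ i, W (i, i) (i, i) = 1 / 3) (i : Fin 3) {p : Fin 3 × Fin 3}
    (hp : p ≠ (i, i)) : W p (i, i) = 0 ∧ W (i, i) p = 0 := by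
  have := psd_zero h.psd (k := (i, i)) (by simp [hd]) p
  simpa [Matrix.one_apply, hp, hp.symm] using this

lemma canon_blockA (h : HW W) (hd : ∀ i, W (i, i) (i, i) = 1 / 3) (i : Fin 3) {k l : Fin 3}
    (hkl : k ≠ l) : W (i, k) (i, l) = 0 := by
  have hp := slice_psd h.bp (Pi.single i 1)
  by_cases hk : i = k
  · have := psd_zero hp (k := l) (by rw [slice_single]; exact canon_diag h hd (hk ▸ hkl)) k
    simpa only [slice_single] using this.1
  · have := psd_zero hp (k := k) (by rw [slice_single]; exact canon_diag h hd hk) l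
    simpa only [slice_single] using this.2

lemma canon_blockB (h : HW W) (hd : ∀ i, W (i, i) (i, i) = 1 / 3) {i j : Fin 3} (k : Fin 3)
    (hij : i ≠ j) : W (i, k) (j, k) = 0 :=
  canon_blockA (W := Sw W) h.sw (fun i => hd i) k hij

lemma canon_zero (h : HW W) (hd : ∀ i, W (i, i) (i, i) = 1 / 3) {i j k l : Fin 3}
    (hn : ¬ (i = k ∧ j = l)) : W (j, k) (i, l) = 0 := by
  by_cases hij : i = j
  · subst hij
    by_cases hkl : k = l
    · subst hkl
      exact canon_diag h hd (fun e => hn ⟨e, e⟩)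
    · exact canon_blockA h hd i hkl
  by_cases hkj : k = j
  · subst hkj
    exact (canon_col h hd k (p := (i, l)) (by simp [hij])).2
  by_cases hli : l = i
  · subst hli
    exact (canon_col h hd l (p := (j, k)) (by simp [Ne.symm hij])).1
  by_cases hkl : k = l
  · subst hkl; exact canon_blockB h hd k (Ne.symm hij)
  -- now one of `k`, `l` is the third index
  have key : ∀ s : ℂ, s * W (j, k) (i, l) + star s * W (i, k) (j, l) = 0 := by
    intro s
    have hp := slice_psd h.bp (Pi.single j 1 + Pi.single i s)
    have z : ∀ m, i ≠ m → j ≠ m → slice W (Pi.single j 1 + Pi.single i s) m m = 0 := by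
      intro m him hjm
      rw [slice_two W hij, canon_diag h hd him, canon_diag h hd hjm, canon_blockB h hd m hij,
        canon_blockB h hd m (Ne.symm hij)]
      simp
    have : slice W (Pi.single j 1 + Pi.single i s) k l = 0 := by
      by_cases hik : i = k
      · exact (psd_zero hp (z l (Ne.symm hli) (fun e => hn ⟨hik, e⟩)) k).1
      · exact (psd_zero hp (z k hik (Ne.symm hkj)) l).2
    rw [slice_two W hij, canon_blockA h hd i hkl, canon_blockA h hd j hkl] at this
    simpa using this
  have k1 := key 1
  have k2 := key Complex.I
  simp at k1 k2
  have k3 : (2 * Complex.I) * W (j, k) (i, l) = 0 := by linear_combination k2 + Complex.I * k1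
  simpa using k3

lemma canon_psd (h : HW W) (hd : ∀ i, W (i, i) (i, i) = 1 / 3) : (ptrans W).PosSemidef := by
  obtain ⟨T, hz⟩ : ∃ T : Fin 3 → Fin 3 → ℂ, ∀ i j k l : Fin 3,
      W (j, k) (i, l) = if i = k ∧ j = l then T k l else 0 := by
    refine ⟨fun k l => W (l, k) (k, l), fun i j k l => ?_⟩
    split_ifs with hc
    · rw [hc.1, hc.2]
    · exact canon_zero h hd hc
  refine PosSemidef.of_dotProduct_mulVec_nonneg ?_ ?_
  · ext p q
    simp only [conjTranspose_apply, ptrans]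
    exact h.bp.1.apply _ _
  · intro x
    have hp := (slice_psd h.bp (fun _ => 1)).dotProduct_mulVec_nonneg (fun k => x (k, k))
    convert hp using 1
    simp only [dotProduct, mulVec, ptrans, slice, Fintype.sum_prod_type, Pi.star_apply]
    simp only [hz]
    simp [Fin.sum_univ_three]

end canon

lemma HW.final {W : Matrix (Fin 3 × Fin 3) (Fin 3 × Fin 3) ℂ} (h : HW W) :
    (ptrans W).PosSemidef := by
  choose u hu hS using fun i => (h.slice_prop i).2
  have hpsd := fun i => slice_psd h.bp (Pi.single i 1)
  have hE : Em W = ∑ i, slice W (Pi.single i 1) := by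
    ext k l
    simp only [Matrix.sum_apply, slice_single, Em]
  have zero : ∀ i j, i ≠ j → slice W (Pi.single i 1) *ᵥ u j = 0 := by
    intro i j hij
    rw [← (hpsd i).dotProduct_mulVec_zero_iff]
    have e : star (u j) ⬝ᵥ Em W *ᵥ u j = 1 / 3 := by
      rw [h.em, smul_mulVec, one_mulVec, dotProduct_smul, hu]; simp
    rw [hE, Matrix.sum_mulVec, dotProduct_sum, ← Finset.add_sum_erase _ _ (Finset.mem_univ j),
      hS, dotProduct_smul, hu, smul_eq_mul, mul_one, add_eq_left] at e
    exact (Finset.sum_eq_zero_iff_of_nonneg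
      fun l _ => (hpsd l).dotProduct_mulVec_nonneg (u j)).1 e i (by simp [hij])
  have orth : ∀ i j, i ≠ j → star (u i) ⬝ᵥ u j = 0 := by
    intro i j hij
    have e : star (slice W (Pi.single i 1) *ᵥ u i) ⬝ᵥ u j = 0 := by
      rw [star_mulVec, ← dotProduct_mulVec, (hpsd i).1.eq, zero i j hij, dotProduct_zero]
    rw [hS, star_smul, smul_dotProduct] at e
    simpa using e
  let V : Matrix (Fin 3) (Fin 3) ℂ := fun k p => star (u k p)
  have hV' : V * Vᴴ = 1 := by
    ext i j
    have : (V * Vᴴ) i j = star (u i) ⬝ᵥ u j := by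
      simp only [Matrix.mul_apply, conjTranspose_apply]
      simp [V, dotProduct]
    rw [this]
    by_cases hij : i = j
    · subst hij; rw [hu]; simp
    · rw [orth i j hij]; simp [hij]
  have hV := mul_eq_one_comm.1 hV'
  have hc := h.cj hV
  have hd : ∀ i, Cj V W (i, i) (i, i) = 1 / 3 := by
    intro i
    have : Cj V W (i, i) (i, i) = star (u i) ⬝ᵥ slice W (Pi.single i 1) *ᵥ u i := by
      simp only [Cj, V, dotProduct, mulVec, slice_single, Pi.star_apply, star_star,
        Fin.sum_univ_three]
      ring
    rw [this, hS, dotProduct_smul, hu]; simp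
  have hp := canon_psd hc hd
  have e : ptrans (Cj V W) = Cj V (ptrans W) := rfl
  rw [e, Cj_eq] at hp
  have hk := kron_unit hV
  generalize (kronecker (1 : Matrix (Fin 3) (Fin 3) ℂ) V) = K at *
  have := hp.conjTranspose_mul_mul_same K
  have e2 : Kᴴ * (K * ptrans W * Kᴴ) * K = ptrans W := by
    calc _ = (Kᴴ * K) * ptrans W * (Kᴴ * K) := by simp only [mul_assoc]
      _ = _ := by rw [hk]; simp
  rwa [e2] at this

lemma HW.of {W : Matrix (Fin 3 × Fin 3) (Fin 3 × Fin 3) ℂ}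
    (hBP : BlockPositive W) (htr : W.trace = 1) (hN : negativity hBP.1 = 1) : HW W := by
  refine ⟨hBP, ?_, htr⟩
  have h1 := tr_sq_le hBP
  rw [herm_sq_trace hBP.1, htr, one_pow] at h1
  have h1' : ∑ i, hBP.1.eigenvalues i ^ 2 ≤ 1 := by exact_mod_cast h1
  have h2 := hBP.1.trace_eq_sum_eigenvalues
  rw [htr] at h2
  have h2' : ∑ i, hBP.1.eigenvalues i = 1 := by
    have e : ∀ x : ℝ, (RCLike.ofReal x : ℂ) = (x : ℂ) := fun _ => rfl
    simp only [e] at h2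
    exact_mod_cast h2.symm
  unfold negativity at hN
  have habs : ∑ i, |hBP.1.eigenvalues i| = 3 := by
    have : ∀ x : ℝ, |x| = x + 2 * max (-x) 0 := by
      intro x
      rcases le_total x 0 with hx | hx
      · rw [abs_of_nonpos hx, max_eq_left (by linarith)]; ring
      · rw [abs_of_nonneg hx, max_eq_right (by linarith)]; ring
    simp only [this]
    rw [Finset.sum_add_distrib, ← Finset.mul_sum, hN, h2']; norm_num
  have hs : ∑ i, (|hBP.1.eigenvalues i| - 1 / 3) ^ 2 ≤ 0 := by
    have : ∀ x : ℝ, (|x| - 1 / 3) ^ 2 = x ^ 2 - 2 / 3 * |x| + 1 / 9 := by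
      intro x; rw [← sq_abs x]; ring
    simp only [this]
    rw [Finset.sum_add_distrib, Finset.sum_sub_distrib, ← Finset.mul_sum, habs]
    simp
    linarith
  have hz := (Finset.sum_eq_zero_iff_of_nonneg (fun i _ => sq_nonneg _)).1
    (le_antisymm hs (Finset.sum_nonneg fun i _ => sq_nonneg _))
  have he : ∀ i, hBP.1.eigenvalues i ^ 2 = 1 / 9 := by
    intro i
    have := hz i (Finset.mem_univ _)
    have : |hBP.1.eigenvalues i| = 1 / 3 := by nlinarith [pow_eq_zero_iff (two_ne_zero) |>.1 this]
    rw [← sq_abs, this]; norm_num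
  rw [herm_sq hBP.1]
  simp only [he]
  have hu : (hBP.1.eigenvectorUnitary : Matrix (Fin 3 × Fin 3) (Fin 3 × Fin 3) ℂ) *
      star (hBP.1.eigenvectorUnitary : Matrix (Fin 3 × Fin 3) (Fin 3 × Fin 3) ℂ) = 1 :=
    Unitary.coe_mul_star_self _
  rw [← smul_one_eq_diagonal, mul_smul_comm, mul_one, smul_mul_assoc, hu]
  norm_num

/-- A normalized `3 × 3` entanglement witness with negativity `1` has positive
semidefinite partial transpose; in particular it is decomposable. -/
theorem stmt_17 (W : Matrix (Fin 3 × Fin 3) (Fin 3 × Fin 3) ℂ)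
    (hBP : BlockPositive W) (hNP : ¬ W.PosSemidef) (htr : W.trace = 1)
    (hN : negativity hBP.1 = 1) :
    (ptrans W).PosSemidef := by
  exact (HW.of hBP htr hN).final

end
end

section
/- Let 2 ≤ m ≤ n and let W be a normalized m×n entanglement witness. Define μ := sSup { re ⟪a⊗b, W.mulVec (a⊗b)⟫ : a : Fin m → ℂ, b : Fin n → ℂ, ‖a‖ = ‖b‖ = 1 }, and let W_M := μ • 1 − W be the mirrored operator. If W_M has a negative eigenvalue (so that W_M is itself an entanglement witness), then the smallest eigenvalue of W satisfies λ_min(W) > −1/2. If in addition W is decomposable, then also tr(W²) < 1 and N(W) < (m − 1)/2. -/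
open Matrix ComplexOrder

noncomputable section

/-- quadratic form -/
def qf {N : Type*} [Fintype N] (W : Matrix N N ℂ) (u : N → ℂ) : ℂ := star u ⬝ᵥ W.mulVec u

lemma qf_expand {N : Type*} [Fintype N] (W : Matrix N N ℂ) (u : N → ℂ) :
    qf W u = ∑ p, ∑ q, star (u p) * W p q * u q := by
  simp only [qf, dotProduct, mulVec, Finset.mul_sum, Pi.star_apply, mul_assoc]

lemma herm_qf_im {N : Type*} [Fintype N] {W : Matrix N N ℂ} (hW : W.IsHermitian) (u : N → ℂ) :
    (qf W u).im = 0 := by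
  have := hW.im_star_dotProduct_mulVec_self u
  simpa [qf] using this

lemma qf_one {N : Type*} [Fintype N] [DecidableEq N] (u : N → ℂ) (μ : ℝ) :
    qf ((μ : ℂ) • (1 : Matrix N N ℂ)) u = ((μ * ∑ p, Complex.normSq (u p) : ℝ) : ℂ) := by
  simp only [qf, smul_mulVec, one_mulVec, dotProduct_smul, smul_eq_mul]
  push_cast
  congr 1
  simp only [dotProduct, Pi.star_apply, RCLike.star_def]
  apply Finset.sum_congr rfl
  intro p _
  rw [Complex.normSq_eq_conj_mul_self]

lemma psd_of_bound {N : Type*} [Fintype N] [DecidableEq N] {W : Matrix N N ℂ} (hW : W.IsHermitian)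
    (μ : ℝ) (h : ∀ u : N → ℂ, (qf W u).re ≤ μ * ∑ p, Complex.normSq (u p)) :
    ((μ : ℂ) • (1 : Matrix N N ℂ) - W).PosSemidef := by
  have hh : ((μ : ℂ) • (1 : Matrix N N ℂ) - W).IsHermitian := by
    refine IsHermitian.sub ?_ hW
    unfold IsHermitian
    simp [conjTranspose_smul]
  refine PosSemidef.of_dotProduct_mulVec_nonneg hh fun u => ?_
  have e : star u ⬝ᵥ ((μ : ℂ) • (1 : Matrix N N ℂ) - W).mulVec u
      = ((μ * ∑ p, Complex.normSq (u p) : ℝ) : ℂ) - qf W u := by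
    rw [← qf_one]
    simp [qf, sub_mulVec, dotProduct_sub]
  rw [e, Complex.le_def]
  constructor
  · have := h u
    simp only [Complex.sub_re, Complex.ofReal_re, Complex.zero_re]; linarith
  · simp [herm_qf_im hW u]

/-- Schur test -/
lemma psd_of_rows {N : Type*} [Fintype N] [DecidableEq N] {W : Matrix N N ℂ} (hW : W.IsHermitian)
    (μ : ℝ) (h : ∀ p, ∑ q, ‖W p q‖ ≤ μ) :
    ((μ : ℂ) • (1 : Matrix N N ℂ) - W).PosSemidef := by
  refine psd_of_bound hW μ fun u => ?_
  have h1 : (qf W u).re ≤ ∑ p, ∑ q, ‖W p q‖ * ((Complex.normSq (u p) + Complex.normSq (u q)) / 2) := by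
    rw [qf_expand, Complex.re_sum]
    refine Finset.sum_le_sum fun p _ => ?_
    rw [Complex.re_sum]
    refine Finset.sum_le_sum fun q _ => ?_
    refine (Complex.re_le_norm _).trans ?_
    rw [norm_mul, norm_mul, norm_star, Complex.normSq_eq_norm_sq, Complex.normSq_eq_norm_sq]
    have := mul_nonneg (norm_nonneg (W p q)) (sq_nonneg (‖u p‖ - ‖u q‖))
    nlinarith
  have hs : ∀ p q, ‖W p q‖ = ‖W q p‖ := by
    intro p q
    rw [← hW.apply p q, norm_star]
  have h2 : ∑ p, ∑ q, ‖W p q‖ * ((Complex.normSq (u p) + Complex.normSq (u q)) / 2)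
      = ∑ p, (∑ q, ‖W p q‖) * Complex.normSq (u p) := by
    have e1 : ∑ p, ∑ q, ‖W p q‖ * ((Complex.normSq (u p) + Complex.normSq (u q)) / 2)
      = (∑ p, ∑ q, ‖W p q‖ * Complex.normSq (u p)) / 2
        + (∑ p, ∑ q, ‖W p q‖ * Complex.normSq (u q)) / 2 := by
      rw [Finset.sum_div, Finset.sum_div, ← Finset.sum_add_distrib]
      refine Finset.sum_congr rfl fun p _ => ?_
      rw [Finset.sum_div, Finset.sum_div, ← Finset.sum_add_distrib]
      refine Finset.sum_congr rfl fun q _ => ?_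
      ring
    have e2 : ∑ p, ∑ q, ‖W p q‖ * Complex.normSq (u q)
        = ∑ p, ∑ q, ‖W p q‖ * Complex.normSq (u p) := by
      rw [Finset.sum_comm]
      refine Finset.sum_congr rfl fun p _ => Finset.sum_congr rfl fun q _ => ?_
      rw [hs]
    rw [e1, e2]
    simp only [Finset.sum_mul]
    ring
  rw [h2] at h1
  refine h1.trans ?_
  rw [Finset.mul_sum]
  exact Finset.sum_le_sum fun p _ => mul_le_mul_of_nonneg_right (h p) (Complex.normSq_nonneg _)

/-- upper bound on product vectors -/
def PB {m n : ℕ} (W : Matrix (Fin m × Fin n) (Fin m × Fin n) ℂ) (μ : ℝ) : Prop :=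
  ∀ (a : Fin m → ℂ) (b : Fin n → ℂ), (qf W (prodVec a b)).re ≤
    μ * ((∑ i, Complex.normSq (a i)) * (∑ i, Complex.normSq (b i)))

lemma qf_smul {N : Type*} [Fintype N] (W : Matrix N N ℂ) (u : N → ℂ) (c : ℂ) :
    qf W (c • u) = (Complex.normSq c : ℂ) * qf W u := by
  simp only [qf, star_smul, mulVec_smul, dotProduct_smul, smul_dotProduct, smul_eq_mul,
    Complex.normSq_eq_conj_mul_self, RCLike.star_def]
  ring

lemma PB_of_sup {m n : ℕ} (W : Matrix (Fin m × Fin n) (Fin m × Fin n) ℂ)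
    (μ : ℝ)
    (hμ : μ = sSup {r : ℝ | ∃ (a : Fin m → ℂ) (b : Fin n → ℂ),
      (∑ i, Complex.normSq (a i)) = 1 ∧ (∑ i, Complex.normSq (b i)) = 1 ∧
      r = (star (prodVec a b) ⬝ᵥ W.mulVec (prodVec a b)).re}) : PB W μ := by
  have hbdd : BddAbove {r : ℝ | ∃ (a : Fin m → ℂ) (b : Fin n → ℂ),
      (∑ i, Complex.normSq (a i)) = 1 ∧ (∑ i, Complex.normSq (b i)) = 1 ∧
      r = (star (prodVec a b) ⬝ᵥ W.mulVec (prodVec a b)).re} := by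
    refine ⟨∑ p, ∑ q, ‖W p q‖, ?_⟩
    rintro r ⟨a, b, ha, hb, rfl⟩
    have key : ∀ {k : ℕ} (c : Fin k → ℂ), (∑ i, Complex.normSq (c i)) = 1 → ∀ i, ‖c i‖ ≤ 1 := by
      intro k c hc i
      have h1 : Complex.normSq (c i) ≤ 1 := by
        rw [← hc]
        exact Finset.single_le_sum (f := fun i => Complex.normSq (c i))
          (fun i _ => Complex.normSq_nonneg _) (Finset.mem_univ i)
      rw [Complex.normSq_eq_norm_sq] at h1
      exact (sq_le_one_iff₀ (norm_nonneg _)).1 h1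
    have kp : ∀ p, ‖prodVec a b p‖ ≤ 1 := fun p => by
      unfold prodVec
      rw [norm_mul]
      exact mul_le_one₀ (key a ha _) (norm_nonneg _) (key b hb _)
    change (qf W (prodVec a b)).re ≤ _
    rw [qf_expand, Complex.re_sum]
    refine Finset.sum_le_sum fun p _ => ?_
    rw [Complex.re_sum]
    refine Finset.sum_le_sum fun q _ => ?_
    refine (Complex.re_le_norm _).trans ?_
    rw [norm_mul, norm_mul, norm_star]
    calc _ ≤ 1 * ‖W p q‖ * 1 := by
          gcongr
          · exact kp p
          · exact kp q
      _ = _ := by ring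
  intro a b
  by_cases ha : (∑ i, Complex.normSq (a i)) = 0
  · have : prodVec a b = 0 := by
      rw [Finset.sum_eq_zero_iff_of_nonneg (fun i _ => Complex.normSq_nonneg _)] at ha
      ext p
      have := ha p.1 (Finset.mem_univ _)
      rw [Complex.normSq_eq_zero] at this
      simp [prodVec, this]
    simp [this, qf, ha]
  by_cases hb : (∑ i, Complex.normSq (b i)) = 0
  · have : prodVec a b = 0 := by
      rw [Finset.sum_eq_zero_iff_of_nonneg (fun i _ => Complex.normSq_nonneg _)] at hb
      ext p
      have := hb p.2 (Finset.mem_univ _)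
      rw [Complex.normSq_eq_zero] at this
      simp [prodVec, this]
    simp [this, qf, hb]
  set A := ∑ i, Complex.normSq (a i)
  set B := ∑ i, Complex.normSq (b i)
  have hA : 0 < A := lt_of_le_of_ne (Finset.sum_nonneg fun i _ => Complex.normSq_nonneg _) (Ne.symm ha)
  have hB : 0 < B := lt_of_le_of_ne (Finset.sum_nonneg fun i _ => Complex.normSq_nonneg _) (Ne.symm hb)
  have hn : ∀ {k : ℕ} (c : Fin k → ℂ) (C : ℝ), 0 < C → (∑ i, Complex.normSq (c i)) = C →
      (∑ i, Complex.normSq (((((Real.sqrt C)⁻¹ : ℝ) : ℂ) • c) i)) = 1 := by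
    intro k c C hC h
    simp only [Pi.smul_apply, smul_eq_mul, map_mul, Complex.normSq_ofReal]
    rw [← Finset.mul_sum, h, ← mul_inv, Real.mul_self_sqrt hC.le, inv_mul_cancel₀ hC.ne']
  have hle := le_csSup hbdd ⟨_, _, hn a A hA rfl, hn b B hB rfl, rfl⟩
  rw [← hμ] at hle
  have e : prodVec ((((Real.sqrt A)⁻¹ : ℝ) : ℂ) • a) ((((Real.sqrt B)⁻¹ : ℝ) : ℂ) • b)
      = ((((Real.sqrt A)⁻¹ * (Real.sqrt B)⁻¹ : ℝ)) : ℂ) • prodVec a b := by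
    ext p; simp [prodVec]; ring
  rw [e] at hle
  change (qf W _).re ≤ μ at hle
  rw [qf_smul, Complex.re_ofReal_mul, Complex.normSq_ofReal] at hle
  have e2 : ((Real.sqrt A)⁻¹ * (Real.sqrt B)⁻¹) * ((Real.sqrt A)⁻¹ * (Real.sqrt B)⁻¹) = (A * B)⁻¹ := by
    have h1 := Real.mul_self_sqrt hA.le
    have h2 := Real.mul_self_sqrt hB.le
    rw [← mul_inv, ← mul_inv]
    congr 1
    calc _ = (Real.sqrt A * Real.sqrt A) * (Real.sqrt B * Real.sqrt B) := by ring
      _ = _ := by rw [h1, h2]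
  rw [e2, inv_mul_le_iff₀ (by positivity)] at hle
  linarith

lemma sum_swap {M : Type*} [AddCommMonoid M] {m n : ℕ} (f : Fin m → Fin n → Fin m → Fin n → M) :
    ∑ i, ∑ k, ∑ j, ∑ l, f j k i l = ∑ i, ∑ k, ∑ j, ∑ l, f i k j l := by
  calc _ = ∑ i, ∑ j, ∑ k, ∑ l, f j k i l := by
        refine Finset.sum_congr rfl fun i _ => ?_
        rw [Finset.sum_comm]
    _ = ∑ j, ∑ i, ∑ k, ∑ l, f j k i l := Finset.sum_comm
    _ = _ := by
        refine Finset.sum_congr rfl fun i _ => ?_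
        rw [Finset.sum_comm]

lemma trace_ptrans {m n : ℕ} (Q : Matrix (Fin m × Fin n) (Fin m × Fin n) ℂ) :
    (ptrans Q).trace = Q.trace := by
  simp [ptrans, Matrix.trace]

lemma ptrans_herm {m n : ℕ} {Q : Matrix (Fin m × Fin n) (Fin m × Fin n) ℂ} (h : Q.IsHermitian) :
    (ptrans Q).IsHermitian := by
  ext p q
  simp only [ptrans, conjTranspose_apply]
  exact h.apply _ _

/-- Frobenius trace as a sum of squares -/
lemma trace_sq {N : Type*} [Fintype N] {Q : Matrix N N ℂ} (h : Q.IsHermitian) :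
    ((Q * Q).trace).re = ∑ p, ∑ q, Complex.normSq (Q p q) := by
  simp only [Matrix.trace, diag_apply, mul_apply, Complex.re_sum]
  refine Finset.sum_congr rfl fun p _ => Finset.sum_congr rfl fun q _ => ?_
  rw [← h.apply q p, RCLike.star_def, Complex.mul_conj, Complex.ofReal_re]

lemma trace_sq_ptrans {m n : ℕ} {Q : Matrix (Fin m × Fin n) (Fin m × Fin n) ℂ} (h : Q.IsHermitian) :
    ((ptrans Q * ptrans Q).trace).re = ((Q * Q).trace).re := by
  rw [trace_sq h, trace_sq (ptrans_herm h)]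
  simp only [ptrans, Fintype.sum_prod_type]
  exact sum_swap (fun i k j l => Complex.normSq (Q (i, k) (j, l)))

lemma psd_trace {N : Type*} [Fintype N] {Q : Matrix N N ℂ} (h : Q.PosSemidef) :
    0 ≤ Q.trace.re ∧ Q.trace = (Q.trace.re : ℂ) := by
  have := h.trace_nonneg
  rw [Complex.le_def] at this
  refine ⟨this.1, ?_⟩
  apply Complex.ext
  · simp
  · simpa using this.2.symm

lemma spec_apply {N : Type*} [Fintype N] [DecidableEq N] {Q : Matrix N N ℂ} (h : Q.IsHermitian) (p q : N) :
    Q p q = ∑ i, (h.eigenvalues i : ℂ) * ((h.eigenvectorUnitary : Matrix N N ℂ) p i *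
      star ((h.eigenvectorUnitary : Matrix N N ℂ) q i)) := by
  conv_lhs => rw [h.spectral_theorem]
  simp only [Unitary.conjStarAlgAut_apply, mul_apply, diagonal_apply, star_apply]
  refine Finset.sum_congr rfl fun i _ => ?_
  simp
  ring

lemma trace_sq_eig {N : Type*} [Fintype N] [DecidableEq N] {Q : Matrix N N ℂ} (h : Q.IsHermitian) :
    ((Q * Q).trace).re = ∑ i, (h.eigenvalues i) ^ 2 := by
  have hU : star (h.eigenvectorUnitary : Matrix N N ℂ) * (h.eigenvectorUnitary : Matrix N N ℂ) = 1 :=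
    Unitary.coe_star_mul_self _
  have : (Q * Q).trace = ∑ i, ((h.eigenvalues i : ℂ)) ^ 2 := by
    have e : Q * Q = (h.eigenvectorUnitary : Matrix N N ℂ) *
      (diagonal (fun i => (h.eigenvalues i : ℂ)) * diagonal (fun i => (h.eigenvalues i : ℂ)))
       * star (h.eigenvectorUnitary : Matrix N N ℂ) := by
      have hs : Q = (h.eigenvectorUnitary : Matrix N N ℂ) *
        diagonal (fun i => (h.eigenvalues i : ℂ)) * star (h.eigenvectorUnitary : Matrix N N ℂ) := by
        conv_lhs => rw [h.spectral_theorem]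
        rfl
      conv_lhs => rw [hs]
      calc _ = (h.eigenvectorUnitary : Matrix N N ℂ) *
        diagonal (fun i => (h.eigenvalues i : ℂ)) * (star (h.eigenvectorUnitary : Matrix N N ℂ) * (h.eigenvectorUnitary : Matrix N N ℂ)) * diagonal (fun i => (h.eigenvalues i : ℂ)) * star (h.eigenvectorUnitary : Matrix N N ℂ) := by
            simp only [mul_assoc]
        _ = _ := by rw [hU]; simp only [mul_assoc, mul_one]
    rw [e, trace_mul_comm, ← mul_assoc, hU, one_mul, diagonal_mul_diagonal, trace_diagonal]
    simp [sq]
  rw [this]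
  rw [Complex.re_sum]
  refine Finset.sum_congr rfl fun i _ => ?_
  rw [← Complex.ofReal_pow, Complex.ofReal_re]

lemma trace_eig {N : Type*} [Fintype N] [DecidableEq N] {Q : Matrix N N ℂ} (h : Q.IsHermitian) :
    (Q.trace).re = ∑ i, (h.eigenvalues i) := by
  rw [h.trace_eq_sum_eigenvalues, Complex.re_sum]
  simp

lemma psd_trace_sq_le {N : Type*} [Fintype N] [DecidableEq N] {Q : Matrix N N ℂ} (h : Q.PosSemidef) :
    ((Q * Q).trace).re ≤ (Q.trace.re) ^ 2 := by
  rw [trace_sq_eig h.1, trace_eig h.1]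
  exact Finset.sum_sq_le_sq_sum_of_nonneg (fun i _ => h.eigenvalues_nonneg i)

lemma rank_one_s18 {N : Type*} [Fintype N] [DecidableEq N] {Q : Matrix N N ℂ} (h : Q.PosSemidef)
    (he : ((Q * Q).trace).re = (Q.trace.re) ^ 2) : ∃ χ : N → ℂ, ∀ p q, Q p q = χ p * star (χ q) := by
  rw [trace_sq_eig h.1, trace_eig h.1] at he
  have hz : ∀ i j, i ≠ j → h.1.eigenvalues i ≠ 0 → h.1.eigenvalues j = 0 := by
    intro i j hij hi
    have hpos : ∀ k, 0 ≤ h.1.eigenvalues k := h.eigenvalues_nonneg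
    have e1 : (∑ k, h.1.eigenvalues k) ^ 2 = ∑ k, h.1.eigenvalues k * (∑ l, h.1.eigenvalues l) := by
      rw [sq, Finset.sum_mul]
    have e2 : ∑ k, h.1.eigenvalues k * ((∑ l, h.1.eigenvalues l) - h.1.eigenvalues k) = 0 := by
      simp only [mul_sub, Finset.sum_sub_distrib]
      rw [← e1, ← he]
      simp [sq]
    have hle : ∀ k, h.1.eigenvalues k ≤ ∑ l, h.1.eigenvalues l := fun k =>
      Finset.single_le_sum (fun i _ => hpos i) (Finset.mem_univ k)
    rw [Finset.sum_eq_zero_iff_of_nonneg (fun k _ => mul_nonneg (hpos k) (by linarith [hle k]))] at e2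
    have e3 := e2 i (Finset.mem_univ _)
    have e4 : (∑ l, h.1.eigenvalues l) = h.1.eigenvalues i := by
      rcases mul_eq_zero.1 e3 with h | h
      · exact absurd h hi
      · linarith
    have e5 : h.1.eigenvalues i + h.1.eigenvalues j ≤ ∑ l, h.1.eigenvalues l := by
      rw [← Finset.sum_pair hij]
      exact Finset.sum_le_sum_of_subset_of_nonneg (Finset.subset_univ _) (fun k _ _ => hpos k)
    linarith [hpos j]
  by_cases hi : ∃ i, h.1.eigenvalues i ≠ 0
  · obtain ⟨i, hi⟩ := hi
    refine ⟨fun p => (Real.sqrt (h.1.eigenvalues i) : ℂ) * (h.1.eigenvectorUnitary : Matrix N N ℂ) p i, ?_⟩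
    intro p q
    rw [spec_apply h.1 p q, Finset.sum_eq_single i]
    · have : (h.1.eigenvalues i : ℂ) = (Real.sqrt (h.1.eigenvalues i) : ℂ) * (Real.sqrt (h.1.eigenvalues i) : ℂ) := by
        rw [← Complex.ofReal_mul, Real.mul_self_sqrt (h.eigenvalues_nonneg i)]
      conv_lhs => rw [this]
      simp
      ring
    · intro j _ hj
      rw [hz i j (Ne.symm hj) hi]; simp
    · simp
  · push Not at hi
    refine ⟨0, fun p q => ?_⟩
    rw [spec_apply h.1 p q]
    simp [hi]

/-- rank one partial transposes have their top eigenvalue at a product vector -/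
lemma rank_one_case {m n : ℕ} {W : Matrix (Fin m × Fin n) (Fin m × Fin n) ℂ} (hW : W.IsHermitian)
    (μ : ℝ) (hμ0 : 0 ≤ μ) (hB : PB W μ) (χ : Fin m × Fin n → ℂ)
    (h : ∀ i k j l, W (i, k) (j, l) = χ (j, k) * star (χ (i, l))) :
    ((μ : ℂ) • (1 : Matrix (Fin m × Fin n) (Fin m × Fin n) ℂ) - W).PosSemidef := by
  -- product values
  have hprod : ∀ a b, qf W (prodVec a b) =
      (Complex.normSq (∑ i, ∑ l, a i * star (b l) * χ (i, l)) : ℂ) := by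
    intro a b
    rw [qf_expand, ← Complex.mul_conj]
    have e1 : (∑ i, ∑ l, a i * star (b l) * χ (i, l)) *
        (starRingEnd ℂ) (∑ i, ∑ l, a i * star (b l) * χ (i, l)) =
        ∑ i, ∑ k, ∑ j, ∑ l, (a i * star (b k) * χ (i, k)) * star (a j * star (b l) * χ (j, l)) := by
      simp only [map_sum, Finset.sum_mul]
      simp only [Finset.mul_sum]
      rfl
    rw [e1, ← sum_swap]
    simp only [Fintype.sum_prod_type, prodVec, h]
    refine Finset.sum_congr rfl fun i _ => Finset.sum_congr rfl fun k _ =>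
      Finset.sum_congr rfl fun j _ => Finset.sum_congr rfl fun l _ => ?_
    simp
    ring
  have hz : ∀ w : Fin n → ℂ, ∑ i, Complex.normSq (∑ l, w l * star (χ (i, l))) ≤
      μ * ∑ l, Complex.normSq (w l) := by
    intro w
    set z : Fin m → ℂ := fun i => ∑ l, w l * star (χ (i, l)) with hzdef
    have h1 := hB z w
    rw [hprod] at h1
    have e : ∑ i, ∑ l, z i * star (w l) * χ (i, l) = ((∑ i, Complex.normSq (z i) : ℝ) : ℂ) := by
      push_cast
      refine Finset.sum_congr rfl fun i _ => ?_
      rw [← Complex.mul_conj]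
      simp only [mul_assoc]
      rw [← Finset.mul_sum]
      congr 1
      simp [hzdef]
    rw [e, Complex.ofReal_re, Complex.normSq_ofReal] at h1
    have hn : 0 ≤ ∑ i, Complex.normSq (z i) := Finset.sum_nonneg fun i _ => Complex.normSq_nonneg _
    rcases hn.eq_or_lt with h0 | h0
    · change ∑ i, Complex.normSq (z i) ≤ _
      rw [← h0]
      exact mul_nonneg hμ0 (Finset.sum_nonneg fun i _ => Complex.normSq_nonneg _)
    · change ∑ i, Complex.normSq (z i) ≤ _
      by_contra hc
      push Not at hc
      nlinarith
  refine psd_of_bound hW μ fun u => ?_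
  set A : Fin m → Fin m → ℂ := fun j i => ∑ l, u (j, l) * star (χ (i, l)) with hA
  have e : qf W u = ∑ i, ∑ j, A j i * star (A i j) := by
    rw [qf_expand]
    simp only [Fintype.sum_prod_type, h]
    refine Finset.sum_congr rfl fun i _ => ?_
    rw [Finset.sum_comm]
    refine Finset.sum_congr rfl fun j _ => ?_
    rw [mul_comm]
    simp only [hA, star_sum, Finset.sum_mul]
    refine Finset.sum_congr rfl fun k _ => ?_
    rw [Finset.mul_sum]
    refine Finset.sum_congr rfl fun l _ => ?_
    simp
    ring
  have h1 : (qf W u).re ≤ ∑ i, ∑ j, (Complex.normSq (A j i) + Complex.normSq (A i j)) / 2 := by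
    rw [e, Complex.re_sum]
    refine Finset.sum_le_sum fun p _ => ?_
    rw [Complex.re_sum]
    refine Finset.sum_le_sum fun q _ => ?_
    refine (Complex.re_le_norm _).trans ?_
    rw [norm_mul, norm_star, Complex.normSq_eq_norm_sq, Complex.normSq_eq_norm_sq]
    nlinarith [sq_nonneg (‖A q p‖ - ‖A p q‖)]
  have h2 : ∑ i, ∑ j, (Complex.normSq (A j i) + Complex.normSq (A i j)) / 2
      = ∑ j, ∑ i, Complex.normSq (A j i) := by
    simp only [add_div, Finset.sum_add_distrib, ← Finset.sum_div]
    rw [Finset.sum_comm]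
    ring
  rw [h2] at h1
  refine h1.trans ?_
  rw [Fintype.sum_prod_type, Finset.mul_sum]
  exact Finset.sum_le_sum fun j _ => hz (fun l => u (j, l))

open scoped MatrixOrder in
lemma psd_factor {N : Type*} [Fintype N] [DecidableEq N] {P : Matrix N N ℂ} (hP : P.PosSemidef) :
    ∃ C : Matrix N N ℂ, P = C * Cᴴ := by
  obtain ⟨B, hB⟩ := CStarAlgebra.nonneg_iff_eq_star_mul_self.mp hP.nonneg
  exact ⟨Bᴴ, by rw [hB]; simp [star_eq_conjTranspose]⟩

lemma frob_zero {A B : Type*} [Fintype A] [Fintype B] (X : Matrix A B ℂ) :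
    0 ≤ ((Xᴴ * X).trace).re ∧ (((Xᴴ * X).trace).re = 0 → X = 0) := by
  have h := posSemidef_conjTranspose_mul_self X
  obtain ⟨h1, h2⟩ := psd_trace h
  refine ⟨h1, fun h0 => ?_⟩
  rw [← trace_conjTranspose_mul_self_eq_zero_iff, h2, h0]
  simp

lemma herm_zero {N : Type*} [Fintype N] {X : Matrix N N ℂ} (h : X.IsHermitian)
    (h0 : ((X * X).trace).re = 0) : X = 0 := by
  exact (frob_zero X).2 (by rw [h.eq]; exact h0)

lemma part_two_a {m n : ℕ} {W P Q : Matrix (Fin m × Fin n) (Fin m × Fin n) ℂ}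
    (hP : P.PosSemidef) (hQ : Q.PosSemidef) (hW : W = P + ptrans Q) (htr : W.trace = 1)
    (hNP : ¬ W.PosSemidef) (μ : ℝ) (hμ0 : 0 ≤ μ) (hB : PB W μ)
    (hWM : ¬ (((μ : ℂ) • (1 : Matrix (Fin m × Fin n) (Fin m × Fin n) ℂ)) - W).PosSemidef) :
    ((W * W).trace).re < 1 := by
  by_contra hc
  push Not at hc
  have hGh := ptrans_herm hQ.1
  have hWh : W.IsHermitian := by rw [hW]; exact hP.1.add hGh
  obtain ⟨hα0, hα⟩ := psd_trace hP
  obtain ⟨hβ0, hβ⟩ := psd_trace hQ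
  have hP2 := psd_trace_sq_le hP
  have hQ2 := psd_trace_sq_le hQ
  rw [← trace_sq_ptrans hQ.1] at hQ2
  have hsum : P.trace.re + Q.trace.re = 1 := by
    have := congrArg Complex.re htr
    rw [hW, trace_add, trace_ptrans] at this
    simpa using this
  set α := P.trace.re
  set β := Q.trace.re
  set G := ptrans Q
  have hexp : ((W * W).trace).re = ((P * P).trace).re + 2 * ((P * G).trace).re + ((G * G).trace).re := by
    rw [hW]
    simp only [add_mul, mul_add, trace_add, Complex.add_re, trace_mul_comm G P]
    ring
  have hDh : ((β : ℂ) • P - (α : ℂ) • G).IsHermitian := by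
    refine IsHermitian.sub ?_ ?_
    · unfold IsHermitian; rw [conjTranspose_smul, hP.1]; simp
    · unfold IsHermitian; rw [conjTranspose_smul, hGh]; simp
  have hD : (((((β : ℂ) • P - (α : ℂ) • G) * ((β : ℂ) • P - (α : ℂ) • G)).trace).re) =
      β ^ 2 * ((P * P).trace).re + α ^ 2 * ((G * G).trace).re - 2 * α * β * ((P * G).trace).re := by
    simp only [sub_mul, mul_sub, trace_sub, Complex.sub_re, smul_mul_assoc, mul_smul_comm, trace_smul,
      smul_eq_mul, trace_mul_comm G P, Complex.re_ofReal_mul]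
    ring
  have hD0 : 0 ≤ (((((β : ℂ) • P - (α : ℂ) • G) * ((β : ℂ) • P - (α : ℂ) • G)).trace).re) := by
    rw [trace_sq hDh]
    exact Finset.sum_nonneg fun i _ => Finset.sum_nonneg fun j _ => Complex.normSq_nonneg _
  rcases hα0.eq_or_lt with h0 | hαp
  · -- P = 0
    have hP0 : P = 0 := by
      rw [← hP.trace_eq_zero_iff, hα, ← h0]; simp
    have hWG : W = G := by rw [hW, hP0, zero_add]
    have hβ1 : β = 1 := by linarith
    have : ((Q * Q).trace).re = β ^ 2 := by
      rw [hWG] at hc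
      have h3 := trace_sq_ptrans hQ.1
      change ((G * G).trace).re = _ at h3
      rw [← h3]
      nlinarith
    obtain ⟨χ, hχ⟩ := rank_one_s18 hQ this
    apply hWM
    refine rank_one_case hWh μ hμ0 hB χ ?_
    intro i k j l
    rw [hWG]
    exact hχ _ _
  rcases hβ0.eq_or_lt with h0 | hβp
  · have hQ0 : Q = 0 := by
      rw [← hQ.trace_eq_zero_iff, hβ, ← h0]; simp
    apply hNP
    have : G = 0 := by
      ext p q
      simp [G, hQ0, ptrans]
    rw [hW, this, add_zero]
    exact hP
  -- both positive
  rw [hD] at hD0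
  have hPG : ((P * G).trace).re ≤ α * β := by
    by_contra hcc
    push Not at hcc
    have h1 : α * β * (α * β) < α * β * ((P * G).trace).re :=
      mul_lt_mul_of_pos_left hcc (mul_pos hαp hβp)
    nlinarith [mul_le_mul_of_nonneg_left hP2 (sq_nonneg β), mul_le_mul_of_nonneg_left hQ2 (sq_nonneg α)]
  have hone : (α + β) ^ 2 = 1 := by rw [hsum]; norm_num
  have e1 : ((P * P).trace).re = α ^ 2 := by nlinarith
  have e2 : ((G * G).trace).re = β ^ 2 := by nlinarith
  have e3 : ((P * G).trace).re = α * β := by nlinarith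
  have hDz : (((((β : ℂ) • P - (α : ℂ) • G) * ((β : ℂ) • P - (α : ℂ) • G)).trace).re) = 0 := by
    rw [hD, e1, e2, e3]; ring
  have hDD : (β : ℂ) • P - (α : ℂ) • G = 0 :=
    herm_zero hDh hDz
  have hαc : (α : ℂ) ≠ 0 := by exact_mod_cast hαp.ne'
  have hG : G = ((β / α : ℝ) : ℂ) • P := by
    have : (α : ℂ) • G = (β : ℂ) • P := (sub_eq_zero.1 hDD).symm
    calc G = (α : ℂ)⁻¹ • ((α : ℂ) • G) := by rw [smul_smul, inv_mul_cancel₀ hαc, one_smul]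
      _ = _ := by rw [this, smul_smul]; congr 1; push_cast; ring
  apply hNP
  rw [hW, hG]
  refine hP.add (hP.smul ?_)
  exact_mod_cast (div_pos hβp hαp).le

/-- block embedding -/
def Eb (m n : ℕ) (i : Fin m) : Matrix (Fin m × Fin n) (Fin n) ℂ :=
  fun p k => if p = (i, k) then 1 else 0

lemma Eb_mul_apply {m n : ℕ} {N : Type*} (i : Fin m) (M : Matrix (Fin n) N ℂ)
    (p : Fin m × Fin n) (c : N) : (Eb m n i * M) p c = if p.1 = i then M p.2 c else 0 := by
  simp only [mul_apply, Eb, Prod.ext_iff]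
  by_cases h : p.1 = i
  · simp [h]
  · simp [h]

lemma EbH_mul_apply {m n : ℕ} {N : Type*} (i : Fin m) (M : Matrix (Fin m × Fin n) N ℂ)
    (k : Fin n) (c : N) : ((Eb m n i)ᴴ * M) k c = M (i, k) c := by
  simp only [mul_apply, Eb, conjTranspose_apply]
  rw [Finset.sum_eq_single (i, k)]
  · simp
  · intro b _ hb; simp [hb]
  · simp

lemma mul_EbH_apply {m n : ℕ} {N : Type*} (i : Fin m) (M : Matrix N (Fin n) ℂ)
    (p : Fin m × Fin n) (c : N) : (M * (Eb m n i)ᴴ) c p = if p.1 = i then M c p.2 else 0 := by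
  simp only [mul_apply, Eb, conjTranspose_apply, Prod.ext_iff]
  by_cases h : p.1 = i
  · simp [h, apply_ite]
  · simp [h]

lemma EbH_Eb {m n : ℕ} (i j : Fin m) : (Eb m n i)ᴴ * Eb m n j = if i = j then 1 else 0 := by
  ext k l
  rw [EbH_mul_apply]
  by_cases h : i = j
  · simp [Eb, h, one_apply]
  · simp [Eb, h]

lemma sum_EE {m n : ℕ} : ∑ i, Eb m n i * (Eb m n i)ᴴ = 1 := by
  ext p q
  rw [Matrix.sum_apply]
  simp only [Eb_mul_apply]
  simp only [conjTranspose_apply, Eb, one_apply, Finset.sum_ite_eq, Finset.mem_univ, if_true]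
  by_cases h : p = q
  · simp [h]
  · simp [h, Ne.symm h]

lemma ptrans_decomp {m n : ℕ} {N : Type*} [Fintype N]
    {Q : Matrix (Fin m × Fin n) (Fin m × Fin n) ℂ} {D : Matrix (Fin m × Fin n) N ℂ}
    (h : Q = D * Dᴴ) :
    ptrans Q = ∑ i, ∑ j, Eb m n i * ((Eb m n j)ᴴ * D) * ((Eb m n i)ᴴ * D)ᴴ * (Eb m n j)ᴴ := by
  ext p q
  rw [Matrix.sum_apply]
  simp only [Matrix.sum_apply, mul_EbH_apply]
  simp only [Matrix.mul_assoc, Eb_mul_apply]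
  simp only [Finset.sum_ite_eq, Finset.mem_univ, if_true]
  rw [EbH_mul_apply, mul_apply]
  simp only [ptrans]
  rw [h, mul_apply]
  refine Finset.sum_congr rfl fun c _ => ?_
  rw [conjTranspose_apply, conjTranspose_apply, EbH_mul_apply]

lemma exists_sign {N : Type*} [Fintype N] [DecidableEq N] {W : Matrix N N ℂ} (h : W.IsHermitian) :
    ∃ S : Matrix N N ℂ, S.IsHermitian ∧ S * S = 1 ∧
      ((S * W).trace).re = W.trace.re + 2 * negativity h := by
  set U : Matrix N N ℂ := (h.eigenvectorUnitary : Matrix N N ℂ) with hUdef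
  have hU : star U * U = 1 := Unitary.coe_star_mul_self _
  have hU' : U * star U = 1 := Unitary.coe_mul_star_self _
  have hs : W = U * diagonal (fun i => (h.eigenvalues i : ℂ)) * star U := by
    conv_lhs => rw [h.spectral_theorem]
    rfl
  set σ : N → ℝ := fun i => if 0 ≤ h.eigenvalues i then 1 else -1 with hσ
  have hσ2 : ∀ i, (σ i : ℂ) * (σ i : ℂ) = 1 := by
    intro i
    simp only [hσ]
    split_ifs <;> simp
  refine ⟨U * diagonal (fun i => (σ i : ℂ)) * star U, ?_, ?_, ?_⟩
  · unfold IsHermitian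
    simp only [conjTranspose_mul, star_eq_conjTranspose, conjTranspose_conjTranspose,
      diagonal_conjTranspose, mul_assoc]
    congr 3
    ext i
    simp
  · calc _ = U * diagonal (fun i => (σ i : ℂ)) * (star U * U) * diagonal (fun i => (σ i : ℂ)) * star U := by
          simp only [mul_assoc]
      _ = U * (diagonal (fun i => (σ i : ℂ)) * diagonal (fun i => (σ i : ℂ))) * star U := by
          rw [hU]; simp only [mul_assoc, mul_one]
      _ = 1 := by
          rw [diagonal_mul_diagonal]
          simp [hσ2, hU']
  · have e : (U * diagonal (fun i => (σ i : ℂ)) * star U * W).trace =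
        ((∑ i, σ i * h.eigenvalues i : ℝ) : ℂ) := by
      conv_lhs => rw [hs]
      calc _ = (U * (diagonal (fun i => (σ i : ℂ)) * (star U * U) * diagonal (fun i => (h.eigenvalues i : ℂ))) * star U).trace := by
            simp only [mul_assoc]
        _ = _ := by
            rw [hU, mul_one, trace_mul_comm, ← mul_assoc, hU, one_mul, diagonal_mul_diagonal, trace_diagonal]
            push_cast
            rfl
    rw [e, Complex.ofReal_re, trace_eig h, negativity, Finset.mul_sum, ← Finset.sum_add_distrib]
    refine Finset.sum_congr rfl fun i _ => ?_
    simp only [hσ]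
    split_ifs with h0
    · rw [max_eq_right (by linarith)]; ring
    · rw [max_eq_left (by linarith)]; ring

lemma swap_identity {m n : ℕ} {N : Type*} [Fintype N]
    {S : Matrix (Fin m × Fin n) (Fin m × Fin n) ℂ} (hS : S.IsHermitian) (hSS : S * S = 1)
    {Q : Matrix (Fin m × Fin n) (Fin m × Fin n) ℂ} {D : Matrix (Fin m × Fin n) N ℂ}
    (h : Q = D * Dᴴ) :
    ∑ i, ∑ j, (((S * (Eb m n i * ((Eb m n j)ᴴ * D)) - Eb m n j * ((Eb m n i)ᴴ * D))ᴴ *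
      (S * (Eb m n i * ((Eb m n j)ᴴ * D)) - Eb m n j * ((Eb m n i)ᴴ * D))).trace).re
     = 2 * m * Q.trace.re - 2 * ((S * ptrans Q).trace).re := by
  set d : Fin m → Matrix (Fin n) N ℂ := fun i => (Eb m n i)ᴴ * D with hd
  have hEE : ∀ i, (Eb m n i)ᴴ * Eb m n i = 1 := fun i => by simp [EbH_Eb]
  have hq : ∑ j, ((d j)ᴴ * d j).trace.re = Q.trace.re := by
    rw [← Complex.re_sum, ← trace_sum, h, trace_mul_comm]
    congr 2
    calc _ = ∑ j, Dᴴ * (Eb m n j * (Eb m n j)ᴴ) * D := by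
          refine Finset.sum_congr rfl fun j _ => ?_
          simp only [hd, conjTranspose_mul, conjTranspose_conjTranspose, Matrix.mul_assoc]
      _ = _ := by
          rw [← Matrix.sum_mul, ← Matrix.mul_sum, sum_EE, Matrix.mul_one]
  have hterm : ∀ i j, (((S * (Eb m n i * d j) - Eb m n j * d i)ᴴ *
      (S * (Eb m n i * d j) - Eb m n j * d i)).trace).re =
      ((d j)ᴴ * d j).trace.re + ((d i)ᴴ * d i).trace.re
        - 2 * ((S * (Eb m n i * d j * (d i)ᴴ * (Eb m n j)ᴴ)).trace).re := by
    intro i j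
    have e1 : (S * (Eb m n i * d j))ᴴ * (S * (Eb m n i * d j)) = (d j)ᴴ * d j := by
      rw [conjTranspose_mul, conjTranspose_mul, hS.eq]
      calc _ = (d j)ᴴ * ((Eb m n i)ᴴ * (S * S) * Eb m n i) * d j := by simp only [Matrix.mul_assoc]
        _ = _ := by rw [hSS, Matrix.mul_one, hEE, Matrix.mul_one]
    have e2 : (Eb m n j * d i)ᴴ * (Eb m n j * d i) = (d i)ᴴ * d i := by
      rw [conjTranspose_mul]
      calc _ = (d i)ᴴ * ((Eb m n j)ᴴ * Eb m n j) * d i := by simp only [Matrix.mul_assoc]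
        _ = _ := by rw [hEE, Matrix.mul_one]
    have e3 : ((Eb m n j * d i)ᴴ * (S * (Eb m n i * d j))).trace =
        (S * (Eb m n i * d j * (d i)ᴴ * (Eb m n j)ᴴ)).trace := by
      rw [trace_mul_comm, conjTranspose_mul]
      simp only [Matrix.mul_assoc]
    have e4 : ((S * (Eb m n i * d j))ᴴ * (Eb m n j * d i)).trace =
        star (S * (Eb m n i * d j * (d i)ᴴ * (Eb m n j)ᴴ)).trace := by
      rw [← e3, ← trace_conjTranspose, conjTranspose_mul _ (S * _), conjTranspose_conjTranspose]
    rw [conjTranspose_sub, Matrix.sub_mul, Matrix.mul_sub, Matrix.mul_sub]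
    simp only [trace_sub, Complex.sub_re]
    rw [e1, e2, e3, e4]
    simp only [RCLike.star_def, Complex.conj_re]
    ring
  rw [Finset.sum_congr rfl (fun i _ => Finset.sum_congr rfl (fun j _ => hterm i j))]
  simp only [Finset.sum_sub_distrib, Finset.sum_add_distrib]
  rw [hq]
  simp only [Finset.sum_const, Finset.card_univ, Fintype.card_fin, nsmul_eq_mul, ← Finset.mul_sum]
  rw [hq]
  have e5 : ∑ i, ∑ j, ((S * (Eb m n i * d j * (d i)ᴴ * (Eb m n j)ᴴ)).trace).re =
      ((S * ptrans Q).trace).re := by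
    rw [ptrans_decomp h]
    simp only [Matrix.mul_sum, trace_sum, Complex.re_sum]
    rfl
  rw [e5]
  ring

lemma psd_le_of_sq {N : Type*} [Fintype N] [DecidableEq N] {G : Matrix N N ℂ} (μ : ℝ) (hμ : 0 < μ)
    (hG : G.PosSemidef) (hGμ : ((μ : ℂ) • (1 : Matrix N N ℂ) - G).PosSemidef) :
    ((μ : ℂ) • G - G * G).PosSemidef := by
  have h1 := hGμ.conjTranspose_mul_mul_same G
  have h2 := hG.conjTranspose_mul_mul_same ((μ : ℂ) • (1 : Matrix N N ℂ) - G)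
  rw [hG.1.eq] at h1
  rw [hGμ.1.eq] at h2
  have h3 := (h1.add h2).smul (a := ((μ⁻¹ : ℝ) : ℂ)) (by exact_mod_cast (inv_pos.2 hμ).le)
  convert h3 using 1
  have hμc : (μ : ℂ) ≠ 0 := by exact_mod_cast hμ.ne'
  simp only [Matrix.sub_mul, Matrix.mul_sub, Matrix.smul_mul, Matrix.mul_smul, Matrix.one_mul, Matrix.mul_one, Matrix.mul_assoc]
  push_cast
  have : (μ : ℂ) • G - G * G = (μ : ℂ)⁻¹ • ((μ : ℂ) • ((μ : ℂ) • G - G * G)) := by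
    rw [smul_smul, inv_mul_cancel₀ hμc, one_smul]
  refine this.trans ?_
  congr 1
  simp only [smul_sub]
  abel

lemma psd_of_sq_le {N : Type*} [Fintype N] [DecidableEq N] {R : Matrix N N ℂ} (μ : ℝ) (hμ : 0 < μ)
    (hR : R.IsHermitian) (h : ((μ : ℂ) • R - R * R).PosSemidef) :
    ((μ : ℂ) • (1 : Matrix N N ℂ) - R).PosSemidef := by
  have hμc : (μ : ℂ) ≠ 0 := by exact_mod_cast hμ.ne'
  have hX : ((μ : ℂ) • (1 : Matrix N N ℂ) - R).IsHermitian := by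
    refine IsHermitian.sub ?_ hR
    unfold IsHermitian
    simp [conjTranspose_smul]
  have h1 := posSemidef_conjTranspose_mul_self ((μ : ℂ) • (1 : Matrix N N ℂ) - R)
  rw [hX.eq] at h1
  have h3 := (h1.add h).smul (a := ((μ⁻¹ : ℝ) : ℂ)) (by exact_mod_cast (inv_pos.2 hμ).le)
  convert h3 using 1
  have : (μ : ℂ) • (1 : Matrix N N ℂ) - R = (μ : ℂ)⁻¹ • ((μ : ℂ) • ((μ : ℂ) • (1 : Matrix N N ℂ) - R)) := by
    rw [smul_smul, inv_mul_cancel₀ hμc, one_smul]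
  refine this.trans ?_
  push_cast
  congr 1
  simp only [Matrix.sub_mul, Matrix.mul_sub, Matrix.smul_mul, Matrix.mul_smul, Matrix.one_mul, Matrix.mul_one, smul_sub]
  abel

lemma ptrans_block {m n : ℕ} {N : Type*} [Fintype N]
    {S : Matrix (Fin m × Fin n) (Fin m × Fin n) ℂ} (hS : S.IsHermitian) (hSS : S * S = 1)
    {W Q : Matrix (Fin m × Fin n) (Fin m × Fin n) ℂ} {D : Matrix (Fin m × Fin n) N ℂ}
    (h : Q = D * Dᴴ) (hW : W = ptrans Q) (hWh : W.IsHermitian) (μ : ℝ) (hμ : 0 < μ) (hB : PB W μ)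
    (hsw : ∀ i j, S * (Eb m n i * ((Eb m n j)ᴴ * D)) = Eb m n j * ((Eb m n i)ᴴ * D)) :
    ((μ : ℂ) • (1 : Matrix (Fin m × Fin n) (Fin m × Fin n) ℂ) - W).PosSemidef := by
  set d : Fin m → Matrix (Fin n) N ℂ := fun i => (Eb m n i)ᴴ * D with hd
  replace hsw : ∀ i j, S * (Eb m n i * d j) = Eb m n j * d i := hsw
  have hEE : ∀ i, (Eb m n i)ᴴ * Eb m n i = 1 := fun i => by simp [EbH_Eb]
  -- orthogonality
  have hort : ∀ j l, j ≠ l → (d j)ᴴ * d l = 0 := by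
    intro j l hjl
    have e1 : (S * (Eb m n j * d j))ᴴ * (S * (Eb m n j * d l)) = (d j)ᴴ * d l := by
      rw [conjTranspose_mul, conjTranspose_mul, hS.eq]
      calc _ = (d j)ᴴ * ((Eb m n j)ᴴ * (S * S) * Eb m n j) * d l := by simp only [Matrix.mul_assoc]
        _ = _ := by rw [hSS, Matrix.mul_one, hEE, Matrix.mul_one]
    rw [← e1, hsw, hsw, conjTranspose_mul]
    calc _ = (d j)ᴴ * ((Eb m n j)ᴴ * Eb m n l) * d j := by simp only [Matrix.mul_assoc]
      _ = 0 := by rw [EbH_Eb, if_neg hjl]; simp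
  set G : Fin m → Matrix (Fin n) (Fin n) ℂ := fun i => d i * (d i)ᴴ with hG
  have hGp : ∀ i, (G i).PosSemidef := fun i => posSemidef_self_mul_conjTranspose _
  set R := ∑ i, G i with hR
  have hRp : R.PosSemidef := posSemidef_sum _ fun i _ => hGp i
  -- blocks bounded
  have hGμ : ∀ i, ((μ : ℂ) • (1 : Matrix (Fin n) (Fin n) ℂ) - G i).PosSemidef := by
    intro i
    refine psd_of_bound (hGp i).1 μ fun b => ?_
    have h1 := hB (Pi.single i 1) b
    have e1 : ∑ j, Complex.normSq ((Pi.single i 1 : Fin m → ℂ) j) = 1 := by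
      rw [Finset.sum_eq_single i]
      · simp
      · intro j _ hj; simp [hj]
      · simp
    rw [e1, one_mul] at h1
    convert h1 using 2
    rw [qf_expand, qf_expand]
    simp only [Fintype.sum_prod_type, prodVec]
    rw [Finset.sum_eq_single i]
    · refine Finset.sum_congr rfl fun k _ => ?_
      rw [Finset.sum_eq_single i]
      · refine Finset.sum_congr rfl fun l _ => ?_
        have : G i k l = W (i, k) (i, l) := by
          rw [hW, h]
          simp only [hG, hd, ptrans, mul_apply, conjTranspose_apply]
          refine Finset.sum_congr rfl fun c _ => ?_
          have e := fun k => EbH_mul_apply i D k c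
          simp only [mul_apply, conjTranspose_apply] at e
          rw [e, e]
        rw [this]; simp
      · intro j _ hj; simp [hj]
      · simp
    · intro j _ hj; simp [hj]
    · simp
  have hGG : ∀ i j, i ≠ j → G i * G j = 0 := by
    intro i j hij
    calc _ = d i * ((d i)ᴴ * d j) * (d j)ᴴ := by simp only [hG, Matrix.mul_assoc]
      _ = 0 := by rw [hort i j hij]; simp
  have hRR : R * R = ∑ i, G i * G i := by
    rw [hR, Matrix.sum_mul]
    refine Finset.sum_congr rfl fun i _ => ?_
    rw [Matrix.mul_sum, Finset.sum_eq_single i]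
    · intro j _ hj; exact hGG i j (Ne.symm hj)
    · simp
  have hRμ : ((μ : ℂ) • (1 : Matrix (Fin n) (Fin n) ℂ) - R).PosSemidef := by
    refine psd_of_sq_le μ hμ hRp.1 ?_
    rw [hRR, hR, Finset.smul_sum, ← Finset.sum_sub_distrib]
    exact posSemidef_sum _ fun i _ => psd_le_of_sq μ hμ (hGp i) (hGμ i)
  -- T = S W
  set T := ∑ j, Eb m n j * R * (Eb m n j)ᴴ with hT
  have hTp : T.PosSemidef := posSemidef_sum _ fun j _ => hRp.mul_mul_conjTranspose_same _
  have hSW : S * W = T := by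
    rw [hW, ptrans_decomp h, hT, Matrix.mul_sum, Finset.sum_congr rfl (fun i _ => Matrix.mul_sum _ _ _), Finset.sum_comm]
    refine Finset.sum_congr rfl fun j _ => ?_
    rw [hR, Matrix.mul_sum, Matrix.sum_mul]
    refine Finset.sum_congr rfl fun i _ => ?_
    calc _ = S * (Eb m n i * d j) * (d i)ᴴ * (Eb m n j)ᴴ := by simp only [hd, Matrix.mul_assoc]
      _ = _ := by rw [hsw]; simp only [hG, Matrix.mul_assoc]
  have hWS : W * S = T := by
    rw [← hTp.1.eq, ← hSW, conjTranspose_mul, hS.eq, hWh.eq]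
  have hST : S * T = W := by rw [← hSW, ← Matrix.mul_assoc, hSS, Matrix.one_mul]
  have h1 : (T - W).PosSemidef := by
    have h2 := (hTp.conjTranspose_mul_mul_same (1 - S)).smul (a := ((2⁻¹ : ℝ) : ℂ))
      (by exact_mod_cast (by norm_num : (0 : ℝ) ≤ 2⁻¹))
    convert h2 using 1
    have e : (1 - S)ᴴ * T * (1 - S) = (2 : ℂ) • (T - W) := by
      rw [conjTranspose_sub, hS.eq, conjTranspose_one, Matrix.sub_mul, hST, Matrix.one_mul,
        Matrix.mul_sub, Matrix.mul_one, Matrix.sub_mul, hWS, ← hWS, Matrix.mul_assoc, hSS, Matrix.mul_one, two_smul]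
      abel
    rw [e, smul_smul]
    norm_num
  have h2 : ((μ : ℂ) • (1 : Matrix (Fin m × Fin n) (Fin m × Fin n) ℂ) - T).PosSemidef := by
    have : (μ : ℂ) • (1 : Matrix (Fin m × Fin n) (Fin m × Fin n) ℂ) - T =
        ∑ j, Eb m n j * ((μ : ℂ) • (1 : Matrix (Fin n) (Fin n) ℂ) - R) * (Eb m n j)ᴴ := by
      rw [hT, ← sum_EE, Finset.smul_sum, ← Finset.sum_sub_distrib]
      refine Finset.sum_congr rfl fun j _ => ?_
      rw [Matrix.mul_sub, Matrix.sub_mul, Matrix.mul_smul, Matrix.mul_one, Matrix.smul_mul]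
    rw [this]
    exact posSemidef_sum _ fun j _ => hRμ.mul_mul_conjTranspose_same _
  convert h2.add h1 using 1
  abel

lemma part_two_b {m n : ℕ} (hm : 2 ≤ m) {W P Q : Matrix (Fin m × Fin n) (Fin m × Fin n) ℂ}
    (hP : P.PosSemidef) (hQ : Q.PosSemidef) (hW : W = P + ptrans Q) (htr : W.trace = 1)
    (hWh : W.IsHermitian) (μ : ℝ) (hμ0 : 0 < μ) (hB : PB W μ)
    (hWM : ¬ (((μ : ℂ) • (1 : Matrix (Fin m × Fin n) (Fin m × Fin n) ℂ)) - W).PosSemidef) :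
    negativity hWh < ((m : ℝ) - 1) / 2 := by
  by_contra hc
  push Not at hc
  obtain ⟨S, hS, hSS, hneg⟩ := exists_sign hWh
  obtain ⟨hα0, hα⟩ := psd_trace hP
  have hsum : P.trace.re + Q.trace.re = 1 := by
    have := congrArg Complex.re htr
    rw [hW, trace_add, trace_ptrans] at this
    simpa using this
  obtain ⟨C, hC⟩ : ∃ C : Matrix (Fin m × Fin n) (Fin m × Fin n) ℂ, P = C * Cᴴ := psd_factor hP
  obtain ⟨D, hD⟩ : ∃ D : Matrix (Fin m × Fin n) (Fin m × Fin n) ℂ, Q = D * Dᴴ := psd_factor hQ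
  have hSP : ((S * P).trace).re ≤ P.trace.re := by
    have h1 := (frob_zero (S * C - C)).1
    have e1 : (S * C)ᴴ * (S * C) = Cᴴ * C := by
      rw [conjTranspose_mul, hS.eq]
      calc _ = Cᴴ * (S * S) * C := by simp only [Matrix.mul_assoc]
        _ = _ := by rw [hSS, Matrix.mul_one]
    have e2 : (Cᴴ * (S * C)).trace = (S * P).trace := by
      rw [trace_mul_comm, hC, Matrix.mul_assoc]
    have e3 : ((S * C)ᴴ * C).trace = star (S * P).trace := by
      rw [← e2, ← trace_conjTranspose, conjTranspose_mul Cᴴ, conjTranspose_conjTranspose]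
    have e4 : (Cᴴ * C).trace = P.trace := by rw [trace_mul_comm, hC]
    rw [conjTranspose_sub, Matrix.sub_mul, Matrix.mul_sub, Matrix.mul_sub] at h1
    simp only [trace_sub, Complex.sub_re] at h1
    rw [e1, e2, e3, e4] at h1
    simp only [RCLike.star_def, Complex.conj_re] at h1
    linarith
  have hid := swap_identity hS hSS hD
  have hnn : ∀ i j, 0 ≤ (((S * (Eb m n i * ((Eb m n j)ᴴ * D)) - Eb m n j * ((Eb m n i)ᴴ * D))ᴴ *
      (S * (Eb m n i * ((Eb m n j)ᴴ * D)) - Eb m n j * ((Eb m n i)ᴴ * D))).trace).re :=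
    fun i j => (frob_zero _).1
  have hF := Finset.sum_nonneg fun i (_ : i ∈ Finset.univ) =>
    Finset.sum_nonneg fun j (_ : j ∈ Finset.univ) => hnn i j
  have hSW : ((S * W).trace).re = ((S * P).trace).re + ((S * ptrans Q).trace).re := by
    rw [hW, Matrix.mul_add, trace_add, Complex.add_re]
  have hm' : (2 : ℝ) ≤ m := by exact_mod_cast hm
  have htr' : W.trace.re = 1 := by rw [htr]; simp
  rw [htr', hSW] at hneg
  have hα00 : P.trace.re = 0 := by
    rw [hid] at hF
    nlinarith
  have hP0 : P = 0 := by
    rw [← hP.trace_eq_zero_iff, hα, hα00]; simp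
  have hF0 : ∑ i, ∑ j, (((S * (Eb m n i * ((Eb m n j)ᴴ * D)) - Eb m n j * ((Eb m n i)ᴴ * D))ᴴ *
      (S * (Eb m n i * ((Eb m n j)ᴴ * D)) - Eb m n j * ((Eb m n i)ᴴ * D))).trace).re = 0 := by
    refine le_antisymm ?_ hF
    rw [hid]
    have : Q.trace.re = 1 := by linarith
    rw [this]
    linarith
  have hsw : ∀ i j, S * (Eb m n i * ((Eb m n j)ᴴ * D)) = Eb m n j * ((Eb m n i)ᴴ * D) := by
    intro i j
    rw [Finset.sum_eq_zero_iff_of_nonneg (fun i _ => Finset.sum_nonneg fun j _ => hnn i j)] at hF0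
    have h1 := hF0 i (Finset.mem_univ _)
    rw [Finset.sum_eq_zero_iff_of_nonneg (fun j _ => hnn i j)] at h1
    exact sub_eq_zero.1 ((frob_zero _).2 (h1 j (Finset.mem_univ _)))
  apply hWM
  exact ptrans_block hS hSS hD (by rw [hW, hP0, zero_add]) hWh μ hμ0 hB hsw

lemma qf_single {N : Type*} [Fintype N] [DecidableEq N] (W : Matrix N N ℂ) (p : N) :
    qf W (Pi.single p 1) = W p p := by
  rw [qf_expand, Finset.sum_eq_single p]
  · rw [Finset.sum_eq_single p]
    · simp
    · intro q _ hq; simp [hq]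
    · simp
  · intro q _ hq; simp [hq]
  · simp

lemma prodVec_single {m n : ℕ} (i : Fin m) (k : Fin n) :
    prodVec (Pi.single i 1) (Pi.single k 1) = Pi.single (i, k) 1 := by
  ext p
  obtain ⟨j, l⟩ := p
  simp only [prodVec, Pi.single_apply, Prod.ext_iff]
  by_cases h1 : j = i <;> by_cases h2 : l = k <;> simp [h1, h2]

lemma bp_diag {m n : ℕ} {W : Matrix (Fin m × Fin n) (Fin m × Fin n) ℂ} (h : BlockPositive W)
    (p : Fin m × Fin n) : 0 ≤ (W p p).re := by
  have := (h.2 (Pi.single p.1 1) (Pi.single p.2 1)).1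
  rw [prodVec_single] at this
  change 0 ≤ (qf W _).re at this
  rwa [qf_single] at this

lemma normSq_single {m : ℕ} (i : Fin m) :
    ∑ j, Complex.normSq ((Pi.single i 1 : Fin m → ℂ) j) = 1 := by
  rw [Finset.sum_eq_single i]
  · simp
  · intro j _ hj; simp [hj]
  · simp

lemma pb_diag {m n : ℕ} {W : Matrix (Fin m × Fin n) (Fin m × Fin n) ℂ} {μ : ℝ} (h : PB W μ)
    (p : Fin m × Fin n) : (W p p).re ≤ μ := by
  have := h (Pi.single p.1 1) (Pi.single p.2 1)
  rw [prodVec_single, qf_single, normSq_single, normSq_single] at this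
  linarith

lemma qf_par {N : Type*} [Fintype N] (W : Matrix N N ℂ) (u v : N → ℂ) :
    qf W (u + v) + qf W (u - v) = 2 * qf W u + 2 * qf W v := by
  simp only [qf, star_add, star_sub, mulVec_add, mulVec_sub, dotProduct_add, dotProduct_sub,
    add_dotProduct, sub_dotProduct]
  ring

lemma qf_two {N : Type*} [Fintype N] [DecidableEq N] {W : Matrix N N ℂ} (hW : W.IsHermitian)
    (p q : N) (c d : ℂ) :
    (qf W (c • Pi.single p 1 + d • Pi.single q 1)).re =
      Complex.normSq c * (W p p).re + Complex.normSq d * (W q q).re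
        + 2 * (star c * d * W p q).re := by
  have e : qf W (c • Pi.single p 1 + d • Pi.single q 1) =
      (Complex.normSq c : ℂ) * W p p + (Complex.normSq d : ℂ) * W q q + star c * d * W p q
        + star (star c * d * W p q) := by
    have hqp : star (W p q) = W q p := hW.apply q p
    have hs : ∀ p q : N, star (Pi.single p 1 : N → ℂ) ⬝ᵥ W.mulVec (Pi.single q 1) = W p q := by
      intro p q
      have : star (Pi.single p 1 : N → ℂ) = Pi.single p 1 := by
        ext r; simp [Pi.single_apply, apply_ite]
      rw [this]; simp
    simp only [qf, star_add, star_smul, mulVec_add, mulVec_smul, dotProduct_add, add_dotProduct,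
      smul_dotProduct, dotProduct_smul, hs, smul_eq_mul, star_mul', star_star, hqp,
      Complex.normSq_eq_conj_mul_self, RCLike.star_def, Complex.conj_conj]
    ring
  rw [e]
  simp only [Complex.add_re, Complex.re_ofReal_mul, RCLike.star_def, Complex.conj_re]
  ring

lemma exists_phase (w : ℂ) : ∃ α : ℂ, ‖α‖ = 1 ∧ α * w = -(‖w‖ : ℂ) := by
  by_cases h : w = 0
  · exact ⟨1, by simp, by simp [h]⟩
  · have hn : (‖w‖ : ℂ) ≠ 0 := by exact_mod_cast norm_ne_zero_iff.2 h
    refine ⟨-(‖w‖ : ℂ) / w, ?_, ?_⟩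
    · rw [norm_div, norm_neg, Complex.norm_real, norm_norm]
      exact div_self (norm_ne_zero_iff.2 h)
    · field_simp

lemma two_by_two {m n : ℕ} {W : Matrix (Fin m × Fin n) (Fin m × Fin n) ℂ} (h : BlockPositive W)
    (i j : Fin m) (k l : Fin n) (r t : ℝ) (hr : 0 < r) (ht : 0 < t) :
    2 * (‖W (i, k) (j, l)‖ + ‖W (i, l) (j, k)‖) ≤
      r ^ 2 * (W (i, k) (i, k)).re + (r ^ 2)⁻¹ * (W (j, l) (j, l)).re
      + t ^ 2 * (W (i, l) (i, l)).re + (t ^ 2)⁻¹ * (W (j, k) (j, k)).re := by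
  obtain ⟨α, hα, hα'⟩ := exists_phase (W (i, k) (j, l))
  obtain ⟨β, hβ, hβ'⟩ := exists_phase (W (i, l) (j, k))
  obtain ⟨z, hz⟩ := IsAlgClosed.exists_pow_nat_eq (α * β) (n := 2) (by norm_num)
  have hzn : ‖z‖ = 1 := by
    have : ‖z‖ ^ 2 = 1 := by rw [← norm_pow, hz, norm_mul, hα, hβ, one_mul]
    exact (pow_eq_one_iff_of_nonneg (norm_nonneg _) (by norm_num)).1 this
  have hz0 : z ≠ 0 := by intro h0; simp [h0] at hzn
  have hzs : star z * z = 1 := by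
    rw [RCLike.star_def, ← Complex.normSq_eq_conj_mul_self, Complex.normSq_eq_norm_sq, hzn]; simp
  have hαs : star α * α = 1 := by
    rw [RCLike.star_def, ← Complex.normSq_eq_conj_mul_self, Complex.normSq_eq_norm_sq, hα]; simp
  set z' := α * star z with hz'
  have hz'n : ‖z'‖ = 1 := by rw [hz', norm_mul, norm_star, hα, hzn, one_mul]
  have hp1 : z * z' = α := by
    rw [hz']; linear_combination α * hzs
  have hp2 : star z' * z = β := by
    rw [hz', star_mul', star_star]
    linear_combination (star α) * hz + β * hαs
  have hrc : (r : ℂ) ≠ 0 := by exact_mod_cast hr.ne'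
  have htc : (t : ℂ) ≠ 0 := by exact_mod_cast ht.ne'
  set y : ℂ := z * ((r * t)⁻¹ : ℝ) with hy
  set y' : ℂ := z' * (t : ℝ) with hy'
  have key : ∀ s : ℂ, prodVec ((1 : ℂ) • Pi.single i 1 + (s * y) • Pi.single j 1)
      ((r : ℂ) • Pi.single k 1 + (s * y') • Pi.single l 1) =
      ((r : ℂ) • Pi.single (i, k) 1 + (s * s * (y * y')) • Pi.single (j, l) 1) +
      s • (y' • Pi.single (i, l) 1 + (y * r) • Pi.single (j, k) 1) := by
    intro s
    simp only [← prodVec_single]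
    ext p
    simp only [prodVec, Pi.add_apply, Pi.smul_apply, smul_eq_mul]
    ring
  have h1 := (h.2 ((1 : ℂ) • Pi.single i 1 + ((1 : ℂ) * y) • Pi.single j 1)
      ((r : ℂ) • Pi.single k 1 + ((1 : ℂ) * y') • Pi.single l 1)).1
  have h2 := (h.2 ((1 : ℂ) • Pi.single i 1 + ((-1 : ℂ) * y) • Pi.single j 1)
      ((r : ℂ) • Pi.single k 1 + ((-1 : ℂ) * y') • Pi.single l 1)).1
  rw [key] at h1 h2
  rw [show (-1 : ℂ) * -1 * (y * y') = y * y' by ring, neg_one_smul, ← sub_eq_add_neg] at h2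
  rw [show (1 : ℂ) * 1 * (y * y') = y * y' by ring, one_smul] at h1
  have h3 := congrArg Complex.re (qf_par W ((r : ℂ) • Pi.single (i, k) 1 + (y * y') • Pi.single (j, l) 1)
    (y' • Pi.single (i, l) 1 + (y * r) • Pi.single (j, k) 1))
  change 0 ≤ (qf W _).re at h1
  change 0 ≤ (qf W _).re at h2
  have e2 : ∀ w : ℂ, (2 * w).re = 2 * w.re := fun w => by simp
  rw [Complex.add_re, Complex.add_re, e2, e2, qf_two h.1, qf_two h.1] at h3
  have f1 : star (r : ℂ) * (y * y') * W (i, k) (j, l) = ((-‖W (i, k) (j, l)‖ : ℝ) : ℂ) := by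
    rw [hy, hy']
    push_cast
    rw [← hα', ← hp1]
    simp only [RCLike.star_def, Complex.conj_ofReal]
    field_simp
  have f2 : star y' * (y * r) * W (i, l) (j, k) = ((-‖W (i, l) (j, k)‖ : ℝ) : ℂ) := by
    rw [hy, hy']
    push_cast
    rw [← hβ', ← hp2]
    simp only [RCLike.star_def, map_mul, Complex.conj_ofReal]
    field_simp
  rw [f1, f2] at h3
  simp only [Complex.ofReal_re] at h3
  have g1 : Complex.normSq (r : ℂ) = r ^ 2 := by rw [Complex.normSq_ofReal]; ring
  have g2 : Complex.normSq (y * y') = (r ^ 2)⁻¹ := by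
    rw [Complex.normSq_eq_norm_sq, hy, hy']
    simp only [norm_mul, Complex.norm_real, Real.norm_eq_abs, abs_of_pos hr, abs_of_pos ht, hzn, hz'n, abs_inv, abs_mul]
    field_simp
  have g3 : Complex.normSq y' = t ^ 2 := by
    rw [Complex.normSq_eq_norm_sq, hy']
    simp only [norm_mul, Complex.norm_real, Real.norm_eq_abs, abs_of_pos ht, hz'n]
    ring
  have g4 : Complex.normSq (y * r) = (t ^ 2)⁻¹ := by
    rw [Complex.normSq_eq_norm_sq, hy]
    simp only [norm_mul, Complex.norm_real, Real.norm_eq_abs, abs_of_pos hr, abs_of_pos ht, hzn, hz'n, abs_inv, abs_mul]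
    field_simp
  rw [g1, g2, g3, g4] at h3
  linarith

lemma single_cond {m : ℕ} (i k j l : Fin m) :
    (-Pi.single i 1 + Pi.single k 1 + Pi.single j 1 - Pi.single l 1 : Fin m → ZMod 3) = 0 ↔
      (i = k ∧ j = l) ∨ (i = j ∧ k = l) := by
  have hinj : ∀ x y : Fin m, (Pi.single x 1 : Fin m → ZMod 3) = Pi.single y 1 → x = y := by
    intro x y hxy
    by_contra hne
    have := congrFun hxy x
    simp [hne] at this
  constructor
  · intro h
    by_cases hk : i = k
    · left
      refine ⟨hk, hinj _ _ ?_⟩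
      subst hk
      rw [neg_add_cancel, zero_add, sub_eq_zero] at h
      exact h
    by_cases hj : i = j
    · right
      refine ⟨hj, hinj _ _ ?_⟩
      subst hj
      have : (Pi.single k 1 - Pi.single l 1 : Fin m → ZMod 3) = 0 := by
        rw [← h]; abel
      exact sub_eq_zero.1 this
    exfalso
    have := congrFun h i
    simp only [Pi.sub_apply, Pi.add_apply, Pi.neg_apply, Pi.single_eq_same, Pi.single_apply, hk, hj, if_false, Pi.zero_apply] at this
    split_ifs at this <;> revert this <;> decide
  · rintro (⟨rfl, rfl⟩ | ⟨rfl, rfl⟩) <;> abel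

lemma averaging {m : ℕ} {X : Matrix (Fin m × Fin m) (Fin m × Fin m) ℂ} (h : BlockPositive X)
    (s : Fin m → ℝ) (hs : ∀ i, 0 ≤ s i) :
    0 ≤ (∑ i, ∑ j, s i * s j * (X (i, i) (j, j)).re) +
      ∑ i, ∑ k, if i = k then 0 else s i * s k * (X (i, k) (i, k)).re := by
  set c : Fin m → ℝ := fun i => Real.sqrt (s i) with hc
  have hcc : ∀ i, c i * c i = s i := fun i => Real.mul_self_sqrt (hs i)
  set z : AddChar (Fin m → ZMod 3) ℂ → Fin m → ℂ := fun φ p => φ (Pi.single p 1) with hz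
  set V : AddChar (Fin m → ZMod 3) ℂ → Fin m × Fin m → ℂ := fun φ =>
    prodVec (fun i => (c i : ℂ) * z φ i) (fun k => (c k : ℂ) * star (z φ k)) with hV
  have h0 : 0 ≤ (∑ φ, qf X (V φ)).re := by
    rw [Complex.re_sum]
    exact Finset.sum_nonneg fun φ _ => (h.2 _ _).1
  have hsum : ∑ φ, qf X (V φ) = (Fintype.card (Fin m → ZMod 3) : ℂ) *
      ∑ p : Fin m × Fin m, ∑ q : Fin m × Fin m,
        if (p.1 = p.2 ∧ q.1 = q.2) ∨ (p.1 = q.1 ∧ p.2 = q.2) then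
          ((c p.1 * c p.2 * c q.1 * c q.2 : ℝ) : ℂ) * X p q else 0 := by
    simp only [qf_expand]
    rw [Finset.sum_comm, Finset.mul_sum]
    refine Finset.sum_congr rfl fun p _ => ?_
    rw [Finset.sum_comm, Finset.mul_sum]
    refine Finset.sum_congr rfl fun q _ => ?_
    have e : ∀ φ : AddChar (Fin m → ZMod 3) ℂ, star (V φ p) * X p q * V φ q =
        ((c p.1 * c p.2 * c q.1 * c q.2 : ℝ) : ℂ) * X p q *
          φ (-Pi.single p.1 1 + Pi.single p.2 1 + Pi.single q.1 1 - Pi.single q.2 1) := by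
      intro φ
      rw [sub_eq_add_neg, AddChar.map_add_eq_mul, AddChar.map_add_eq_mul, AddChar.map_add_eq_mul,
        AddChar.map_neg_eq_conj, AddChar.map_neg_eq_conj]
      simp only [hV, hz, prodVec, star_mul', star_star, RCLike.star_def, Complex.conj_ofReal, Complex.conj_conj]
      push_cast
      ring
    simp only [e]
    rw [← Finset.mul_sum, AddChar.sum_apply_eq_ite]
    by_cases hcond : (p.1 = p.2 ∧ q.1 = q.2) ∨ (p.1 = q.1 ∧ p.2 = q.2)
    · rw [if_pos hcond, if_pos ((single_cond _ _ _ _).2 hcond)]; ring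
    · rw [if_neg hcond, if_neg (fun hh => hcond ((single_cond _ _ _ _).1 hh))]; ring
  rw [hsum] at h0
  have hcard : (0 : ℝ) < (Fintype.card (Fin m → ZMod 3) : ℝ) := by
    exact_mod_cast Fintype.card_pos
  rw [← Complex.ofReal_natCast, Complex.re_ofReal_mul] at h0
  have h1 := nonneg_of_mul_nonneg_right h0 hcard
  refine h1.trans_eq ?_
  have split : ∀ p q : Fin m × Fin m,
      ((if (p.1 = p.2 ∧ q.1 = q.2) ∨ (p.1 = q.1 ∧ p.2 = q.2) then
          ((c p.1 * c p.2 * c q.1 * c q.2 : ℝ) : ℂ) * X p q else 0) : ℂ).re =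
      (if p.1 = p.2 then (if q.1 = q.2 then s p.1 * s q.1 * (X p q).re else 0) else 0) +
      (if p = q then (if p.1 = p.2 then 0 else s p.1 * s p.2 * (X p p).re) else 0) := by
    rintro ⟨i, k⟩ ⟨j, l⟩
    simp only [Prod.mk.injEq]
    by_cases h1 : i = k
    · subst h1
      by_cases h2 : j = l
      · subst h2
        simp only [true_and, and_self, true_or, if_true, Complex.re_ofReal_mul, ← hcc, ite_self, add_zero]
        ring
      · have : ¬ (i = j ∧ i = l) := fun hh => h2 (hh.1.symm.trans hh.2)
        simp [h2, this]
    · by_cases h2 : i = j ∧ k = l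
      · obtain ⟨rfl, rfl⟩ := h2
        simp only [h1, false_and, and_self, or_true, if_true, if_false, Complex.re_ofReal_mul, ← hcc, zero_add]
        ring
      · simp [h1, h2]
  rw [Complex.re_sum, Finset.sum_congr rfl (fun p _ => (Complex.re_sum _ _).trans
    (Finset.sum_congr rfl (fun q _ => split p q)))]
  simp only [Finset.sum_add_distrib]
  congr 1
  · simp [Fintype.sum_prod_type]
  · simp [Fintype.sum_prod_type]

lemma bp_sub {m n : ℕ} (hmn : m ≤ n) {W : Matrix (Fin m × Fin n) (Fin m × Fin n) ℂ}
    (h : BlockPositive W) :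
    BlockPositive (W.submatrix (Prod.map id (Fin.castLE hmn)) (Prod.map id (Fin.castLE hmn)) :
      Matrix (Fin m × Fin m) (Fin m × Fin m) ℂ) := by
  refine ⟨h.1.submatrix _, fun a b => ?_⟩
  have hinj : Function.Injective (Fin.castLE hmn) := Fin.castLE_injective hmn
  have hinj2 : Function.Injective (Prod.map (id : Fin m → Fin m) (Fin.castLE hmn)) :=
    Function.injective_id.prodMap hinj
  set b' : Fin n → ℂ := Function.extend (Fin.castLE hmn) b 0 with hb'
  have hb1 : ∀ k, b' (Fin.castLE hmn k) = b k := fun k => hinj.extend_apply _ _ _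
  have hz : ∀ p : Fin m × Fin n, p ∉ Set.range (Prod.map (id : Fin m → Fin m) (Fin.castLE hmn)) →
      prodVec a b' p = 0 := by
    intro p hp
    have : ¬ ∃ k, Fin.castLE hmn k = p.2 := by
      rintro ⟨k, hk⟩
      exact hp ⟨(p.1, k), by simp [Prod.ext_iff, hk]⟩
    simp [prodVec, hb', Function.extend_apply' _ _ _ this]
  have e : qf (W.submatrix (Prod.map id (Fin.castLE hmn)) (Prod.map id (Fin.castLE hmn)))
      (prodVec a b) = qf W (prodVec a b') := by
    rw [qf_expand, qf_expand]
    refine Fintype.sum_of_injective _ hinj2 _ _ ?_ ?_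
    · intro p hp; simp [hz p hp]
    · intro p
      refine Fintype.sum_of_injective _ hinj2 _ _ ?_ ?_
      · intro q hq; simp [hz q hq]
      · intro q
        simp [prodVec, hb1]
  change 0 ≤ (qf _ _).re ∧ (qf _ _).im = 0
  rw [e]
  exact h.2 a b'

lemma scale_exists {A B : ℝ} (hA : 0 ≤ A) (hB : 0 ≤ B) (h : A * B = 0) (ε : ℝ) (hε : 0 < ε) :
    ∃ r : ℝ, 0 < r ∧ r ^ 2 * A + (r ^ 2)⁻¹ * B ≤ ε := by
  rcases mul_eq_zero.1 h with h0 | h0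
  · refine ⟨Real.sqrt ((B + 1) / ε), by positivity, ?_⟩
    rw [Real.sq_sqrt (by positivity), h0, inv_div, mul_zero, zero_add, div_mul_eq_mul_div,
      div_le_iff₀ (by positivity)]
    nlinarith
  · refine ⟨Real.sqrt (ε / (A + 1)), by positivity, ?_⟩
    rw [Real.sq_sqrt (by positivity), h0, mul_zero, add_zero, div_mul_eq_mul_div,
      div_le_iff₀ (by positivity)]
    nlinarith

lemma entry_zero {m n : ℕ} {W : Matrix (Fin m × Fin n) (Fin m × Fin n) ℂ} (h : BlockPositive W)
    (i j : Fin m) (k l : Fin n)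
    (h1 : (W (i, k) (i, k)).re * (W (j, l) (j, l)).re = 0)
    (h2 : (W (i, l) (i, l)).re * (W (j, k) (j, k)).re = 0) : W (i, k) (j, l) = 0 := by
  by_contra hne
  have hpos : 0 < ‖W (i, k) (j, l)‖ := norm_pos_iff.2 hne
  obtain ⟨r, hr, hr'⟩ := scale_exists (bp_diag h _) (bp_diag h _) h1 (‖W (i, k) (j, l)‖ / 2) (by positivity)
  obtain ⟨t, ht, ht'⟩ := scale_exists (bp_diag h _) (bp_diag h _) h2 (‖W (i, k) (j, l)‖ / 2) (by positivity)
  have := two_by_two h i j k l r t hr ht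
  have := norm_nonneg (W (i, l) (j, k))
  linarith

lemma core {m n : ℕ} (hmn : m ≤ n) {W : Matrix (Fin m × Fin n) (Fin m × Fin n) ℂ}
    (h : BlockPositive W) (htr : W.trace = 1) (μ : ℝ) (hB : PB W μ)
    (s : Fin m → ℝ) (hs : ∀ i, 0 ≤ s i) (hs1 : ∑ i, s i ^ 2 = 1)
    (hq : ∑ i, ∑ j, s i * s j * (W (i, Fin.castLE hmn i) (j, Fin.castLE hmn j)).re ≤ -(1 / 2)) :
    ((μ : ℂ) • (1 : Matrix (Fin m × Fin n) (Fin m × Fin n) ℂ) - W).PosSemidef := by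
  have hinj : Function.Injective (Fin.castLE hmn) := Fin.castLE_injective hmn
  set ι := Fin.castLE hmn with hι
  have hD0 := bp_diag h
  have hDsum : ∑ p, (W p p).re = 1 := by
    have := congrArg Complex.re htr
    rw [trace, Complex.re_sum] at this
    simpa using this
  have hpair : ∀ i k, i ≠ k → s i ^ 2 + s k ^ 2 ≤ 1 := by
    intro i k hik
    rw [← hs1, ← Finset.sum_pair (f := fun i => s i ^ 2) hik]
    exact Finset.sum_le_sum_of_subset_of_nonneg (Finset.subset_univ _) fun _ _ _ => sq_nonneg _
  set s' : Fin n → ℝ := Function.extend ι s 0 with hs'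
  have hs'1 : ∀ k, s' (ι k) = s k := fun k => hinj.extend_apply _ _ _
  have hs'0 : ∀ k, k ∉ Set.range ι → s' k = 0 := fun k hk => by
    rw [hs', Function.extend_apply' _ _ _ (fun hh => hk hh)]; rfl
  set w : Fin m × Fin n → ℝ := fun p => if ι p.1 = p.2 then 0 else s p.1 * s' p.2 with hw
  have hav := averaging (bp_sub hmn h) s hs
  simp only [submatrix_apply, Prod.map_apply, id] at hav
  have hsumw : ∑ i, ∑ k, (if i = k then 0 else s i * s k * (W (i, ι k) (i, ι k)).re) =
      ∑ p, w p * (W p p).re := by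
    rw [Fintype.sum_prod_type]
    refine Finset.sum_congr rfl fun i _ => ?_
    refine Fintype.sum_of_injective ι hinj _ _ ?_ ?_
    · intro k hk; simp [hw, hs'0 k hk]
    · intro k
      simp only [hw, hs'1, hinj.eq_iff]
      split_ifs <;> simp
  have hw_le : ∀ p, w p ≤ 1 / 2 := by
    rintro ⟨i, k⟩
    simp only [hw]
    split_ifs with hik
    · norm_num
    · by_cases hk : k ∈ Set.range ι
      · obtain ⟨k', rfl⟩ := hk
        rw [hs'1]
        have := hpair i k' (fun hh => hik (by rw [hh]))
        nlinarith [sq_nonneg (s i - s k')]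
      · rw [hs'0 k hk]; norm_num
  have hterm : ∀ p, (1 / 2 - w p) * (W p p).re = 0 := by
    have hnn : ∀ p ∈ Finset.univ, 0 ≤ (1 / 2 - w p) * (W p p).re := fun p _ =>
      mul_nonneg (by linarith [hw_le p]) (hD0 p)
    have hz : ∑ p, (1 / 2 - w p) * (W p p).re = 0 := by
      refine le_antisymm ?_ (Finset.sum_nonneg hnn)
      simp only [sub_mul, Finset.sum_sub_distrib, ← Finset.mul_sum, hDsum]
      rw [← hsumw]
      linarith
    intro p
    exact (Finset.sum_eq_zero_iff_of_nonneg hnn).1 hz p (Finset.mem_univ _)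
  have hsupp : ∀ p, (W p p).re ≠ 0 → ∃ k, p.2 = ι k ∧ p.1 ≠ k ∧ s p.1 * s k = 1 / 2 := by
    intro p hp
    have h1 : w p = 1 / 2 := by
      have := (mul_eq_zero.1 (hterm p)).resolve_right hp
      linarith
    simp only [hw] at h1
    split_ifs at h1 with hik
    · norm_num at h1
    · by_cases hk : p.2 ∈ Set.range ι
      · obtain ⟨k', hk'⟩ := hk
        rw [← hk', hs'1] at h1
        exact ⟨k', hk'.symm, fun hh => hik (by rw [hh, hk']), h1⟩
      · rw [hs'0 _ hk] at h1; norm_num at h1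
  obtain ⟨p0, hp0⟩ : ∃ p, (W p p).re ≠ 0 := by
    by_contra hcon
    push Not at hcon
    rw [Finset.sum_eq_zero fun p _ => hcon p] at hDsum
    norm_num at hDsum
  obtain ⟨k0, -, hik, hprod⟩ := hsupp p0 hp0
  set i0 := p0.1
  have hsq := hpair i0 k0 hik
  have heq : s i0 = s k0 := by nlinarith [sq_nonneg (s i0 - s k0)]
  have hothers : ∀ i, i ≠ i0 → i ≠ k0 → s i = 0 := by
    intro i h1 h2
    have : s i ^ 2 + (s i0 ^ 2 + s k0 ^ 2) ≤ 1 := by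
      rw [← hs1, ← Finset.sum_pair (f := fun i => s i ^ 2) hik,
        ← Finset.sum_insert (f := fun i => s i ^ 2) (by simp [h1, h2])]
      exact Finset.sum_le_sum_of_subset_of_nonneg (Finset.subset_univ _) fun _ _ _ => sq_nonneg _
    have h3 : s i ^ 2 ≤ 0 := by rw [heq] at this hprod; nlinarith
    exact pow_eq_zero_iff (two_ne_zero) |>.1 (le_antisymm h3 (sq_nonneg _))
  have hmem : ∀ i, s i ≠ 0 → i = i0 ∨ i = k0 := by
    intro i hi
    by_contra hcon
    push Not at hcon
    exact hi (hothers i hcon.1 hcon.2)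
  have hDz : ∀ p, p ≠ (i0, ι k0) → p ≠ (k0, ι i0) → (W p p).re = 0 := by
    rintro ⟨i, k⟩ h1 h2
    by_contra hne
    obtain ⟨k', hk', hik', hpr⟩ := hsupp _ hne
    simp only at hk' hik' hpr
    subst hk'
    have a1 := hmem i (by intro h0; rw [h0] at hpr; norm_num at hpr)
    have a2 := hmem k' (by intro h0; rw [h0] at hpr; norm_num at hpr)
    rcases a1 with rfl | rfl <;> rcases a2 with rfl | rfl
    · exact hik' rfl
    · exact h1 rfl
    · exact h2 rfl
    · exact hik' rfl
  have hιne : ι i0 ≠ ι k0 := fun hh => hik (hinj hh)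
  have hPne : ((i0, ι k0) : Fin m × Fin n) ≠ (k0, ι i0) := fun hh => hik (Prod.ext_iff.1 hh).1
  have hpq : (W (i0, ι k0) (i0, ι k0)).re + (W (k0, ι i0) (k0, ι i0)).re = 1 := by
    rw [← hDsum, Fintype.sum_eq_add _ _ hPne fun p hp => hDz p hp.1 hp.2]
  have hz00 : (W (i0, ι i0) (i0, ι i0)).re = 0 :=
    hDz _ (fun hh => hιne (Prod.ext_iff.1 hh).2) (fun hh => hik (Prod.ext_iff.1 hh).1)
  have hz11 : (W (k0, ι k0) (k0, ι k0)).re = 0 :=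
    hDz _ (fun hh => hik (Prod.ext_iff.1 hh).1.symm) (fun hh => hιne (Prod.ext_iff.1 hh).2.symm)
  have hherm : ∀ p q, W q p = star (W p q) := fun p q => (h.1.apply q p).symm
  have hc : (W (i0, ι i0) (k0, ι k0)).re ≤ -(1 / 2) := by
    have e : ∑ i, ∑ j, s i * s j * (W (i, ι i) (j, ι j)).re = (W (i0, ι i0) (k0, ι k0)).re := by
      rw [Fintype.sum_eq_add i0 k0 hik (fun i hi => by
        simp [hothers i hi.1 hi.2])]
      rw [Fintype.sum_eq_add i0 k0 hik (fun i hi => by simp [hothers i hi.1 hi.2]),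
        Fintype.sum_eq_add i0 k0 hik (fun i hi => by simp [hothers i hi.1 hi.2]), hz00, hz11,
        hherm (i0, ι i0) (k0, ι k0), RCLike.star_def, Complex.conj_re, mul_comm (s k0), hprod]
      ring
    rw [← e]; exact hq
  have hcn : 1 / 2 ≤ ‖W (i0, ι i0) (k0, ι k0)‖ := by
    have := Complex.abs_re_le_norm (W (i0, ι i0) (k0, ι k0))
    have := neg_abs_le (W (i0, ι i0) (k0, ι k0)).re
    linarith
  have h22 := two_by_two h i0 k0 (ι i0) (ι k0) 1 1 one_pos one_pos
  rw [hz00, hz11] at h22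
  norm_num at h22
  have hd0 : W (i0, ι k0) (k0, ι i0) = 0 := by
    rw [← norm_le_zero_iff]; linarith
  have hceq : ‖W (i0, ι i0) (k0, ι k0)‖ = 1 / 2 := by
    have := norm_nonneg (W (i0, ι k0) (k0, ι i0))
    linarith
  have hμ : 1 / 2 ≤ μ := by
    have := pb_diag hB (i0, ι k0)
    have := pb_diag hB (k0, ι i0)
    linarith
  have hDmem : ∀ p, (W p p).re ≠ 0 → p = (i0, ι k0) ∨ p = (k0, ι i0) := by
    intro p hp
    by_contra hcon
    push Not at hcon
    exact hp (hDz p hcon.1 hcon.2)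
  have hoff : ∀ p q, p ≠ q → W p q ≠ 0 →
      (p = (i0, ι i0) ∧ q = (k0, ι k0)) ∨ (p = (k0, ι k0) ∧ q = (i0, ι i0)) := by
    rintro ⟨i, k⟩ ⟨j, l⟩ hpq' hne
    by_cases h1 : (W (i, k) (i, k)).re * (W (j, l) (j, l)).re = 0
    · by_cases h2 : (W (i, l) (i, l)).re * (W (j, k) (j, k)).re = 0
      · exact absurd (entry_zero h i j k l h1 h2) hne
      · have a1 := hDmem _ (left_ne_zero_of_mul h2)
        have a2 := hDmem _ (right_ne_zero_of_mul h2)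
        simp only [Prod.mk.injEq] at a1 a2 ⊢ 
        rcases a1 with ⟨rfl, rfl⟩ | ⟨rfl, rfl⟩ <;> rcases a2 with ⟨rfl, rfl⟩ | ⟨rfl, rfl⟩
        · exact absurd rfl hpq'
        · left; simp
        · right; simp
        · exact absurd rfl hpq'
    · exfalso
      have a1 := hDmem _ (left_ne_zero_of_mul h1)
      have a2 := hDmem _ (right_ne_zero_of_mul h1)
      rcases a1 with a1 | a1 <;> rcases a2 with a2 | a2
      · exact hpq' (a1.trans a2.symm)
      · rw [a1, a2] at hne; exact hne hd0
      · rw [a1, a2, hherm (i0, ι k0), hd0] at hne; simp at hne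
      · exact hpq' (a1.trans a2.symm)
  have hdiag : ∀ p, ‖W p p‖ = (W p p).re := by
    intro p
    have : W p p = (((W p p).re : ℝ) : ℂ) := by
      rw [Complex.ext_iff]
      refine ⟨by simp, ?_⟩
      have h1 := congrArg Complex.im (hherm p p)
      rw [RCLike.star_def, Complex.conj_im] at h1
      simp only [Complex.ofReal_im]; linarith
    conv_lhs => rw [this]
    rw [Complex.norm_real, Real.norm_eq_abs, abs_of_nonneg (hD0 p)]
  have hCne : ((i0, ι i0) : Fin m × Fin n) ≠ (k0, ι k0) := fun hh => hik (Prod.ext_iff.1 hh).1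
  refine psd_of_rows h.1 μ fun p => ?_
  by_cases h1 : p = (i0, ι i0)
  · rw [Fintype.sum_eq_single (k0, ι k0)]
    · rw [h1, hceq]; exact hμ
    · intro q hq'
      by_cases hpq' : p = q
      · rw [← hpq', hdiag, h1, hz00]
      · by_contra hne
        rcases hoff p q hpq' (norm_ne_zero_iff.1 hne) with ⟨_, hh⟩ | ⟨hh, _⟩
        · exact hq' hh
        · exact hCne (h1.symm.trans hh)
  by_cases h2 : p = (k0, ι k0)
  · rw [Fintype.sum_eq_single (i0, ι i0)]
    · rw [h2, hherm (i0, ι i0), norm_star, hceq]; exact hμ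
    · intro q hq'
      by_cases hpq' : p = q
      · rw [← hpq', hdiag, h2, hz11]
      · by_contra hne
        rcases hoff p q hpq' (norm_ne_zero_iff.1 hne) with ⟨hh, _⟩ | ⟨_, hh⟩
        · exact h1 hh
        · exact hq' hh
  rw [Fintype.sum_eq_single p]
  · rw [hdiag]; exact pb_diag hB p
  · intro q hq'
    by_contra hne
    rcases hoff p q (Ne.symm hq') (norm_ne_zero_iff.1 hne) with ⟨hh, _⟩ | ⟨hh, _⟩
    · exact h1 hh
    · exact h2 hh

lemma schmidt {m n : ℕ} (hmn : m ≤ n) (ψ : Fin m × Fin n → ℂ)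
    (h1 : ∑ p, Complex.normSq (ψ p) = 1) :
    ∃ (U : Matrix (Fin m) (Fin m) ℂ) (V : Matrix (Fin n) (Fin n) ℂ) (s : Fin m → ℝ),
      Uᴴ * U = 1 ∧ Vᴴ * V = 1 ∧ (∀ i, 0 ≤ s i) ∧ ∑ i, s i ^ 2 = 1 ∧
      ∀ i k, ψ (i, k) = ∑ j, (s j : ℂ) * (U i j * V k (Fin.castLE hmn j)) := by
  have hinj : Function.Injective (Fin.castLE hmn) := Fin.castLE_injective hmn
  set X : Matrix (Fin m) (Fin n) ℂ := Matrix.of fun i k => ψ (i, k) with hX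
  have hH : (X * Xᴴ).PosSemidef := posSemidef_self_mul_conjTranspose X
  set U : Matrix (Fin m) (Fin m) ℂ := (hH.1.eigenvectorUnitary : Matrix (Fin m) (Fin m) ℂ) with hUdef
  set lam := hH.1.eigenvalues with hlam
  have hU : Uᴴ * U = 1 := Unitary.coe_star_mul_self _
  have hU' : U * Uᴴ = 1 := Unitary.coe_mul_star_self _
  have hspec : X * Xᴴ = U * diagonal (fun i => (lam i : ℂ)) * Uᴴ := by
    conv_lhs => rw [hH.1.spectral_theorem]
    rfl
  have hlam0 : ∀ j, 0 ≤ lam j := hH.eigenvalues_nonneg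
  set Y := Uᴴ * X with hY
  have hYY : Y * Yᴴ = diagonal (fun i => (lam i : ℂ)) := by
    calc Y * Yᴴ = Uᴴ * (X * Xᴴ) * U := by
          rw [hY, conjTranspose_mul, conjTranspose_conjTranspose]; simp only [Matrix.mul_assoc]
      _ = (Uᴴ * U) * diagonal (fun i => (lam i : ℂ)) * (Uᴴ * U) := by
          rw [hspec]; simp only [Matrix.mul_assoc]
      _ = _ := by rw [hU, Matrix.one_mul, Matrix.mul_one]
  have hXY : X = U * Y := by rw [hY, ← Matrix.mul_assoc, hU', Matrix.one_mul]
  have hYe : ∀ j j', ∑ k, Y j k * star (Y j' k) = if j = j' then (lam j : ℂ) else 0 := by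
    intro j j'
    have := congrFun (congrFun hYY j) j'
    rw [mul_apply, diagonal_apply] at this
    simpa only [conjTranspose_apply] using this
  have hY0 : ∀ j, lam j = 0 → ∀ k, Y j k = 0 := by
    intro j hj k
    have h2 := hYe j j
    rw [if_pos rfl, hj] at h2
    have h3 : ∑ k, Complex.normSq (Y j k) = 0 := by
      have h4 : ((∑ k, Complex.normSq (Y j k) : ℝ) : ℂ) = 0 := by
        rw [← Complex.ofReal_zero, ← h2]
        push_cast
        refine Finset.sum_congr rfl fun k _ => ?_
        rw [Complex.normSq_eq_conj_mul_self, RCLike.star_def, mul_comm]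
      exact_mod_cast h4
    rw [Finset.sum_eq_zero_iff_of_nonneg (fun i _ => Complex.normSq_nonneg _)] at h3
    exact Complex.normSq_eq_zero.1 (h3 k (Finset.mem_univ _))
  set s : Fin m → ℝ := fun j => Real.sqrt (lam j) with hs
  have hss : ∀ j, s j ^ 2 = lam j := fun j => Real.sq_sqrt (hlam0 j)
  set v : Fin n → EuclideanSpace ℂ (Fin n) :=
    Function.extend (Fin.castLE hmn) (fun j => WithLp.toLp 2 (fun k => (s j : ℂ)⁻¹ * Y j k)) 0 with hv
  have hv1 : ∀ j, v (Fin.castLE hmn j) = WithLp.toLp 2 (fun k => (s j : ℂ)⁻¹ * Y j k) :=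
    fun j => hinj.extend_apply _ _ _
  set S : Set (Fin n) := {l | ∃ j, Fin.castLE hmn j = l ∧ lam j ≠ 0} with hS
  have horth : Orthonormal ℂ (S.domRestrict v) := by
    rw [orthonormal_iff_ite]
    rintro ⟨_, j, rfl, hj⟩ ⟨_, j', rfl, hj'⟩
    have hsj : (s j : ℂ) ≠ 0 := by
      intro h0
      apply hj
      rw [← hss j]
      have : s j = 0 := by exact_mod_cast h0
      rw [this]; norm_num
    simp only [Set.domRestrict_apply, hv1, Subtype.mk.injEq, hinj.eq_iff]
    rw [EuclideanSpace.inner_eq_star_dotProduct]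
    simp only [dotProduct, Pi.star_apply, star_mul', RCLike.star_def, map_inv₀, Complex.conj_ofReal]
    have e : ∀ k, (s j' : ℂ)⁻¹ * Y j' k * ((s j : ℂ)⁻¹ * (starRingEnd ℂ) (Y j k)) =
        ((s j' : ℂ)⁻¹ * (s j : ℂ)⁻¹) * (Y j' k * star (Y j k)) := by
      intro k; rw [RCLike.star_def]; ring
    simp only [e]
    rw [← Finset.mul_sum, hYe]
    by_cases hjj : j = j'
    · subst hjj
      simp only [if_true]
      rw [← hss j]
      push_cast
      field_simp
    · rw [if_neg (Ne.symm hjj), if_neg hjj, mul_zero]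
  obtain ⟨b, hb⟩ := horth.exists_orthonormalBasis_extension_of_card_eq (by simp)
  refine ⟨U, Matrix.of fun k l => b l k, s, hU, ?_, fun j => Real.sqrt_nonneg _, ?_, ?_⟩
  · ext l l'
    have := (orthonormal_iff_ite.1 b.orthonormal) l l'
    rw [EuclideanSpace.inner_eq_star_dotProduct] at this
    rw [mul_apply, one_apply, ← this]
    simp only [dotProduct, conjTranspose_apply, of_apply, Pi.star_apply]
    exact Finset.sum_congr rfl fun k _ => mul_comm _ _
  · have h2 : (X * Xᴴ).trace = ((∑ j, lam j : ℝ) : ℂ) := by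
      rw [hspec, trace_mul_comm, ← Matrix.mul_assoc, hU, Matrix.one_mul, trace_diagonal]
      push_cast; rfl
    have h3 : (X * Xᴴ).trace = ((∑ p, Complex.normSq (ψ p) : ℝ) : ℂ) := by
      rw [Fintype.sum_prod_type, trace]
      push_cast
      refine Finset.sum_congr rfl fun i _ => ?_
      rw [diag_apply, mul_apply]
      refine Finset.sum_congr rfl fun k _ => ?_
      rw [conjTranspose_apply, Complex.normSq_eq_conj_mul_self, RCLike.star_def, mul_comm]
      rfl
    rw [h2, h1] at h3
    simp only [hss]
    exact_mod_cast h3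
  · intro i k
    have e : ψ (i, k) = (U * Y) i k := by rw [← hXY]; rfl
    rw [e, mul_apply]
    refine Finset.sum_congr rfl fun j _ => ?_
    have e2 : Y j k = (s j : ℂ) * b (Fin.castLE hmn j) k := by
      by_cases hj : lam j = 0
      · rw [hY0 j hj, hs]; simp [hj]
      · have hsj : (s j : ℂ) ≠ 0 := by
          intro h0
          apply hj
          rw [← hss j]
          have : s j = 0 := by exact_mod_cast h0
          rw [this]; norm_num
        rw [hb _ ⟨j, rfl, hj⟩, hv1]
        simp only
        rw [← mul_assoc, mul_inv_cancel₀ hsj, one_mul]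
    rw [e2, of_apply]; ring

/-- local operator `U ⊗ V` -/
def loc {m n : ℕ} (U : Matrix (Fin m) (Fin m) ℂ) (V : Matrix (Fin n) (Fin n) ℂ) :
    Matrix (Fin m × Fin n) (Fin m × Fin n) ℂ := Matrix.of fun p q => U p.1 q.1 * V p.2 q.2

lemma loc_prod {m n : ℕ} (U : Matrix (Fin m) (Fin m) ℂ) (V : Matrix (Fin n) (Fin n) ℂ)
    (a : Fin m → ℂ) (b : Fin n → ℂ) :
    (loc U V).mulVec (prodVec a b) = prodVec (U.mulVec a) (V.mulVec b) := by
  ext p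
  simp only [mulVec, dotProduct, prodVec, loc, of_apply, Fintype.sum_prod_type, Finset.sum_mul_sum]
  refine Finset.sum_congr rfl fun i _ => Finset.sum_congr rfl fun k _ => ?_
  ring

lemma loc_unitary {m n : ℕ} {U : Matrix (Fin m) (Fin m) ℂ} {V : Matrix (Fin n) (Fin n) ℂ}
    (hU : Uᴴ * U = 1) (hV : Vᴴ * V = 1) : (loc U V)ᴴ * loc U V = 1 := by
  ext p q
  have h1 := congrFun (congrFun hU p.1) q.1
  have h2 := congrFun (congrFun hV p.2) q.2
  rw [mul_apply] at h1 h2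
  rw [mul_apply, Fintype.sum_prod_type]
  simp only [conjTranspose_apply] at h1 h2
  simp only [conjTranspose_apply, loc, of_apply, star_mul']
  calc _ = (∑ i, star (U i p.1) * U i q.1) * (∑ k, star (V k p.2) * V k q.2) := by
        rw [Finset.sum_mul_sum]
        refine Finset.sum_congr rfl fun i _ => Finset.sum_congr rfl fun k _ => ?_
        ring
    _ = _ := by
        rw [h1, h2, one_apply, one_apply, one_apply]
        by_cases a : p.1 = q.1 <;> by_cases b : p.2 = q.2 <;> simp [a, b, Prod.ext_iff]

lemma qf_conj {N : Type*} [Fintype N] (W K : Matrix N N ℂ) (u : N → ℂ) :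
    qf (Kᴴ * W * K) u = qf W (K.mulVec u) := by
  simp only [qf, star_mulVec, ← mulVec_mulVec, dotProduct_mulVec, vecMul_vecMul]

lemma normSq_unitary {N : Type*} [Fintype N] [DecidableEq N] {U : Matrix N N ℂ} (hU : Uᴴ * U = 1)
    (a : N → ℂ) : ∑ i, Complex.normSq (U.mulVec a i) = ∑ i, Complex.normSq (a i) := by
  have h1 := qf_one (U.mulVec a) 1
  have h2 := qf_one a 1
  rw [← qf_conj] at h1
  simp only [Complex.ofReal_one, one_smul, Matrix.mul_one, hU, one_mul] at h1 h2
  rw [h1] at h2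
  exact_mod_cast h2

lemma part_one {m n : ℕ} (hmn : m ≤ n) {W : Matrix (Fin m × Fin n) (Fin m × Fin n) ℂ}
    (h : BlockPositive W) (htr : W.trace = 1) (μ : ℝ) (hB : PB W μ)
    (ψ : Fin m × Fin n → ℂ) (h1 : ∑ p, Complex.normSq (ψ p) = 1)
    (hq : (qf W ψ).re ≤ -(1 / 2)) :
    ((μ : ℂ) • (1 : Matrix (Fin m × Fin n) (Fin m × Fin n) ℂ) - W).PosSemidef := by
  obtain ⟨U, V, s, hU, hV, hs, hs1, hψ⟩ := schmidt hmn ψ h1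
  have hinj : Function.Injective (Fin.castLE hmn) := Fin.castLE_injective hmn
  set K := loc U V with hK
  have hKK : Kᴴ * K = 1 := loc_unitary hU hV
  have hKK' : K * Kᴴ = 1 := mul_eq_one_comm.1 hKK
  set W' := Kᴴ * W * K with hW'
  have hbp : BlockPositive W' := by
    refine ⟨?_, fun a b => ?_⟩
    · unfold IsHermitian
      simp only [hW', conjTranspose_mul, conjTranspose_conjTranspose, h.1.eq, Matrix.mul_assoc]
    · change 0 ≤ (qf _ _).re ∧ (qf _ _).im = 0
      rw [hW', qf_conj, loc_prod]
      exact h.2 _ _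
  have htr' : W'.trace = 1 := by
    rw [hW', Matrix.mul_assoc, trace_mul_comm, Matrix.mul_assoc, hKK', Matrix.mul_one, htr]
  have hB' : PB W' μ := by
    intro a b
    rw [hW', qf_conj, loc_prod, ← normSq_unitary hU a, ← normSq_unitary hV b]
    exact hB _ _
  set φ : Fin m × Fin n → ℂ := fun p => if p.2 = Fin.castLE hmn p.1 then (s p.1 : ℂ) else 0 with hφ
  have hKφ : K.mulVec φ = ψ := by
    ext ⟨i, k⟩
    rw [hψ]
    simp only [mulVec, dotProduct, Fintype.sum_prod_type, hφ, hK, loc, of_apply]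
    refine Finset.sum_congr rfl fun j _ => ?_
    simp only [mul_ite, mul_zero, Finset.sum_ite_eq', Finset.mem_univ, if_true]
    ring
  have hq' : ∑ i, ∑ j, s i * s j * (W' (i, Fin.castLE hmn i) (j, Fin.castLE hmn j)).re ≤ -(1 / 2) := by
    rw [← hKφ, ← qf_conj, ← hW', qf_expand] at hq
    refine le_of_eq_of_le ?_ hq
    rw [Complex.re_sum, Fintype.sum_prod_type]
    refine Finset.sum_congr rfl fun i _ => ?_
    rw [Fintype.sum_eq_single (Fin.castLE hmn i)]
    · rw [Complex.re_sum, Fintype.sum_prod_type]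
      refine Finset.sum_congr rfl fun j _ => ?_
      rw [Fintype.sum_eq_single (Fin.castLE hmn j)]
      · simp only [hφ, if_true, RCLike.star_def, Complex.conj_ofReal]
        rw [Complex.re_mul_ofReal, Complex.re_ofReal_mul]
        ring
      · intro l hl; simp [hφ, hl]
    · intro k hk; simp [hφ, hk]
  have hfin := (core hmn hbp htr' μ hB' s hs hs1 hq').conjTranspose_mul_mul_same Kᴴ
  convert hfin using 1
  rw [conjTranspose_conjTranspose, Matrix.mul_sub, Matrix.sub_mul, hW']
  congr 1
  · rw [Matrix.mul_smul, Matrix.mul_one, Matrix.smul_mul, hKK']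
  · calc W = (K * Kᴴ) * W * (K * Kᴴ) := by rw [hKK', Matrix.one_mul, Matrix.mul_one]
      _ = _ := by simp only [Matrix.mul_assoc]

/-- Necessary conditions for a normalized `m × n` entanglement witness to
possess a mirrored entanglement witness `W_M = μ•1 - W`. -/
theorem stmt_18 {m n : ℕ} (hm : 2 ≤ m) (hmn : m ≤ n)
    (W : Matrix (Fin m × Fin n) (Fin m × Fin n) ℂ)
    (hBP : BlockPositive W) (hNP : ¬ W.PosSemidef) (htr : W.trace = 1)
    (μ : ℝ)
    (hμ : μ = sSup {r : ℝ | ∃ (a : Fin m → ℂ) (b : Fin n → ℂ),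
      (∑ i, Complex.normSq (a i)) = 1 ∧ (∑ i, Complex.normSq (b i)) = 1 ∧
      r = (star (prodVec a b) ⬝ᵥ W.mulVec (prodVec a b)).re})
    (hWM : ¬ (((μ : ℂ) • (1 : Matrix (Fin m × Fin n) (Fin m × Fin n) ℂ)) - W).PosSemidef) :
    -(1 / 2) < (⨅ i, hBP.1.eigenvalues i) ∧
    (Decomposable W →
      ((W * W).trace).re < 1 ∧ negativity hBP.1 < ((m : ℝ) - 1) / 2) := by
  have hB := PB_of_sup W μ hμ
  have hDsum : ∑ p, (W p p).re = 1 := by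
    have := congrArg Complex.re htr
    rw [trace, Complex.re_sum] at this
    simpa using this
  have hμ0 : 0 < μ := by
    by_contra hcon
    push Not at hcon
    have : ∑ p, (W p p).re ≤ 0 := Finset.sum_nonpos fun p _ => (pb_diag hB p).trans hcon
    linarith
  refine ⟨?_, ?_⟩
  · by_contra hcon
    push Not at hcon
    have : Nonempty (Fin m × Fin n) := ⟨(⟨0, by omega⟩, ⟨0, by omega⟩)⟩
    obtain ⟨i, hi⟩ := exists_eq_ciInf_of_finite (f := hBP.1.eigenvalues)
    rw [← hi] at hcon
    apply hWM
    have hn : ∑ p, Complex.normSq (hBP.1.eigenvectorBasis i p) = 1 := by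
      have h2 := hBP.1.eigenvectorBasis.orthonormal.1 i
      rw [EuclideanSpace.norm_eq, Real.sqrt_eq_one] at h2
      rw [← h2]
      exact Finset.sum_congr rfl fun p _ => Complex.normSq_eq_norm_sq _
    refine part_one hmn hBP htr μ hB (fun p => hBP.1.eigenvectorBasis i p) hn ?_
    refine le_of_eq_of_le ?_ hcon
    have h3 := hBP.1.eigenvalues_eq i
    rw [h3]
    rfl
  · rintro ⟨P, Q, hP, hQ, hW⟩
    exact ⟨part_two_a hP hQ hW htr hNP μ hμ0.le hB hWM,
      part_two_b hm hP hQ hW htr hBP.1 μ hμ0 hB hWM⟩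

end
end
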